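/- arXiv:1009.1866 — 3 statements merged into one kernel-verified Lean document; each statement's English description precedes it below -/
import Mathlib

section
/- Every polygon P(ν) generated by the angular partitioning method for a node ν at level k of the binary tree is a (π/(2k+6))-separated polygon, and consequently has aspect ratio O(k). -/
open MeasureTheory Real RealInnerProductSpace

/-- The Euclidean plane. -/
abbrev Plane := EuclideanSpace ℝ (Fin 2)

/-- The unit square. -/
def unitSquare : Set Plane := {x | x 0 ∈ Set.Icc (0:ℝ) 1 ∧ x 1 ∈ Set.Icc (0:ℝ) 1}

/-- Sides of the unit square. -/
def topSide : Set Plane := {x ∈ unitSquare | x 1 = 1}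
def bottomSide : Set Plane := {x ∈ unitSquare | x 1 = 0}
def leftSide : Set Plane := {x ∈ unitSquare | x 0 = 0}
def rightSide : Set Plane := {x ∈ unitSquare | x 0 = 1}

/-- The segment from `a` to `b` is an edge of `P`: a nondegenerate maximal segment
contained in the frontier of `P`. -/
def IsEdgeOf (P : Set Plane) (a b : Plane) : Prop :=
  a ≠ b ∧ segment ℝ a b ⊆ frontier P ∧
    ∀ c d : Plane, segment ℝ a b ⊆ segment ℝ c d → segment ℝ c d ⊆ frontier P →
      segment ℝ c d = segment ℝ a b

/-- The (smaller) angle between the lines spanned by two direction vectors. -/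
noncomputable def lineAngle (u v : Plane) : ℝ :=
  min (InnerProductGeometry.angle u v) (π - InnerProductGeometry.angle u v)

/-- A convex polygon `P ⊆ U` is `φ`-separated if any two distinct edges either make an
angle of at least `φ`, or lie on opposite sides of the unit square `U`. -/
def SeparatedPolygon (φ : ℝ) (P : Set Plane) : Prop :=
  P ⊆ unitSquare ∧
  ∀ a b a' b' : Plane, IsEdgeOf P a b → IsEdgeOf P a' b' →
    segment ℝ a b ≠ segment ℝ a' b' →
    φ ≤ lineAngle (b - a) (b' - a') ∨
    (segment ℝ a b ⊆ topSide ∧ segment ℝ a' b' ⊆ bottomSide) ∨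
    (segment ℝ a b ⊆ bottomSide ∧ segment ℝ a' b' ⊆ topSide) ∨
    (segment ℝ a b ⊆ leftSide ∧ segment ℝ a' b' ⊆ rightSide) ∨
    (segment ℝ a b ⊆ rightSide ∧ segment ℝ a' b' ⊆ leftSide)

/-- The minimum angle that the direction `v` makes with the edges of `P`. -/
noncomputable def minEdgeAngle (P : Set Plane) (v : Plane) : ℝ :=
  sInf {t : ℝ | ∃ a b : Plane, IsEdgeOf P a b ∧ t = lineAngle v (b - a)}

/-- The direction `u` maximizes, over all directions, the minimum angle made with the
edges of `P` (the choice of the angular cutting method). -/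
def IsAngularBestDir (P : Set Plane) (u : Plane) : Prop :=
  u ≠ 0 ∧ ∀ v : Plane, v ≠ 0 → minEdgeAngle P v ≤ minEdgeAngle P u

/-- `Q` is one of the two polygons obtained by cutting `P` with a straight line of
direction `u`. -/
def IsCutPiece (P Q : Set Plane) (u : Plane) : Prop :=
  ∃ (n : Plane) (c : ℝ), n ≠ 0 ∧ ⟪u, n⟫ = 0 ∧
    (Q = P ∩ {x | ⟪n, x⟫ ≤ c} ∨ Q = P ∩ {x | c ≤ ⟪n, x⟫})

open InnerProductGeometry in
theorem lineAngle_comm (u v : Plane) : lineAngle u v = lineAngle v u := by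
  simp only [lineAngle, angle_comm]

open InnerProductGeometry in
theorem lineAngle_nonneg (u v : Plane) : 0 ≤ lineAngle u v :=
  le_min (angle_nonneg u v) (sub_nonneg.2 (angle_le_pi u v))

theorem lineAngle_le_pi_div_two (u v : Plane) : lineAngle u v ≤ π / 2 := by
  unfold lineAngle
  rcases le_total (InnerProductGeometry.angle u v) (π / 2) with h | h
  · exact min_le_of_left_le h
  · exact min_le_of_right_le (by linarith)

open InnerProductGeometry in
theorem lineAngle_smul_right {c : ℝ} (hc : c ≠ 0) (u v : Plane) :
    lineAngle u (c • v) = lineAngle u v := by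
  unfold lineAngle
  rcases lt_or_gt_of_ne hc with h | h
  · rw [angle_smul_right_of_neg _ _ h, angle_neg_right, min_comm]
    congr 1
    ring
  · rw [angle_smul_right_of_pos _ _ h]

theorem lineAngle_smul_left {c : ℝ} (hc : c ≠ 0) (u v : Plane) :
    lineAngle (c • u) v = lineAngle u v := by
  rw [lineAngle_comm, lineAngle_smul_right hc, lineAngle_comm]

open InnerProductGeometry in
theorem lineAngle_triangle (x y z : Plane) :
    lineAngle x z ≤ lineAngle x y + lineAngle y z := by
  have h1 := angle_le_angle_add_angle x y z
  have h2 := angle_le_angle_add_angle x (-y) z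
  have h3 := angle_le_angle_add_angle x y (-z)
  have h4 := angle_le_angle_add_angle x (-y) (-z)
  simp only [angle_neg_left, angle_neg_right] at h2 h3 h4
  unfold lineAngle
  rcases min_choice (angle x y) (π - angle x y) with h | h <;>
  rcases min_choice (angle y z) (π - angle y z) with h' | h' <;> rw [h, h']
  · exact min_le_of_left_le h1
  · exact min_le_of_right_le h3
  · exact min_le_of_right_le (by linarith)
  · exact min_le_of_left_le h2

open InnerProductGeometry in
theorem lineAngle_eq_pi_div_two_of_inner_eq_zero {u v : Plane} (h : ⟪u, v⟫ = 0) :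
    lineAngle u v = π / 2 := by
  rw [lineAngle, (inner_eq_zero_iff_angle_eq_pi_div_two u v).1 h]
  exact min_eq_left (by linarith)

theorem plane_inner (u v : Plane) : ⟪u, v⟫ = u 0 * v 0 + u 1 * v 1 := by
  simp [PiLp.inner_apply, Fin.sum_univ_two, mul_comm]

theorem plane_norm_sq (u : Plane) : ‖u‖ ^ 2 = u 0 ^ 2 + u 1 ^ 2 := by
  simp [EuclideanSpace.norm_sq_eq, Fin.sum_univ_two]

theorem plane_ext {u v : Plane} (h0 : u 0 = v 0) (h1 : u 1 = v 1) : u = v := by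
  ext i
  fin_cases i
  · exact h0
  · exact h1

/-- If the cross product of two vectors is small, then so is the angle between their lines. -/
theorem lineAngle_le_of_abs_cross_le {u v : Plane} (hu : u ≠ 0) (hv : v ≠ 0) {K : ℝ}
    (h : |u 0 * v 1 - u 1 * v 0| ≤ K * (‖u‖ * ‖v‖)) : lineAngle u v ≤ π / 2 * K := by
  have hsin : Real.sin (lineAngle u v) * (‖u‖ * ‖v‖) = |u 0 * v 1 - u 1 * v 0| := by
    have : Real.sin (lineAngle u v) = Real.sin (InnerProductGeometry.angle u v) := by
      unfold lineAngle
      rcases min_choice (InnerProductGeometry.angle u v)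
        (π - InnerProductGeometry.angle u v) with h | h <;> rw [h]
      exact Real.sin_pi_sub _
    rw [this, InnerProductGeometry.sin_angle_mul_norm_mul_norm, ← Real.sqrt_sq_eq_abs]
    congr 1
    simp only [plane_inner]
    ring
  have hpos : 0 < ‖u‖ * ‖v‖ := mul_pos (norm_pos_iff.2 hu) (norm_pos_iff.2 hv)
  have hK : Real.sin (lineAngle u v) ≤ K := le_of_mul_le_mul_right (hsin ▸ h) hpos
  have := (Real.mul_le_sin (lineAngle_nonneg u v) (lineAngle_le_pi_div_two u v)).trans hK
  calc lineAngle u v = π / 2 * (2 / π * lineAngle u v) := by field_simp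
    _ ≤ π / 2 * K := by gcongr

/-- Given at most `m` directions, some direction makes an angle at least `π / (2 (m + 1))` with
each of them. -/
theorem exists_direction_lineAngle_ge (T : Finset Plane) {m : ℕ} (hT : T.card ≤ m) :
    ∃ v : Plane, v ≠ 0 ∧ ∀ e ∈ T, π / (2 * ((m : ℝ) + 1)) ≤ lineAngle v e := by
  by_contra! hcon
  let d : ℕ → Plane := fun j => !₂[Real.cos (j * (π / (m + 1))), Real.sin (j * (π / (m + 1)))]
  have hnorm (j : ℕ) : ‖d j‖ = 1 := by
    have : ‖d j‖ ^ 2 = 1 := by rw [plane_norm_sq]; simp [d]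
    exact (sq_eq_sq₀ (norm_nonneg _) zero_le_one).1 (by simpa using this)
  have hne (j : ℕ) : d j ≠ 0 := norm_ne_zero_iff.1 (by rw [hnorm]; exact one_ne_zero)
  have hm : (0 : ℝ) < m + 1 := by positivity
  have hfar (i j : ℕ) (hij : i < j) (hj : j < m + 1) : π / (m + 1) ≤ lineAngle (d i) (d j) := by
    have hij' : (i : ℝ) + 1 ≤ j := by exact_mod_cast hij
    have hj' : (j : ℝ) ≤ m := by exact_mod_cast Nat.lt_succ_iff.1 hj
    have hstep : 0 < π / (m + 1) := div_pos Real.pi_pos hm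
    have hπ : (m + 1) * (π / (m + 1)) = π := by field_simp
    have hi0 : (0 : ℝ) ≤ i := Nat.cast_nonneg i
    have hang : InnerProductGeometry.angle (d i) (d j) = (j - i : ℝ) * (π / (m + 1)) := by
      rw [InnerProductGeometry.angle, hnorm, hnorm, plane_inner]
      have : d i 0 * d j 0 + d i 1 * d j 1 = Real.cos ((j - i : ℝ) * (π / (m + 1))) := by
        rw [sub_mul, Real.cos_sub]
        simp only [d, Matrix.cons_val_zero, Matrix.cons_val_one]
        ring
      rw [this, one_mul, div_one, Real.arccos_cos]
      · exact mul_nonneg (by linarith) hstep.le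
      · nlinarith
    rw [lineAngle, hang]
    exact le_min (by nlinarith) (by nlinarith)
  choose! f hfT hf using fun j => hcon (d j) (hne j)
  obtain ⟨i, hi, j, hj, hij, hfij⟩ :=
    Finset.exists_ne_map_eq_of_card_lt_of_maps_to (s := Finset.range (m + 1)) (t := T) (f := f)
      (by simpa using Nat.lt_succ_of_le hT) (fun j _ => hfT j)
  have key (i j : ℕ) (hij : i < j) (hj : j < m + 1) (h : f i = f j) : False := by
    have h1 := hfar i j hij hj
    have h2 := lineAngle_triangle (d i) (f i) (d j)
    have h3 := hf i
    have h4 := hf j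
    rw [lineAngle_comm, ← h] at h4
    have : π / (m + 1) = π / (2 * ((m : ℝ) + 1)) + π / (2 * ((m : ℝ) + 1)) := by
      field_simp
      ring
    linarith
  rw [Finset.mem_range] at hi hj
  rcases lt_or_gt_of_ne hij with h | h
  · exact key i j h hj hfij
  · exact key j i h hi hfij.symm

theorem eq_zero_of_inner_eq_zero_of_inner_eq_zero {n r w : Plane} (hn : n ≠ 0) (hr : r ≠ 0)
    (hnr : ⟪n, r⟫ = 0) (hnw : ⟪n, w⟫ = 0) (hrw : ⟪r, w⟫ = 0) : w = 0 := by
  have hn' : n 0 ^ 2 + n 1 ^ 2 ≠ 0 := by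
    rw [← plane_norm_sq]; exact pow_ne_zero 2 (norm_ne_zero_iff.2 hn)
  have hr' : r 0 ^ 2 + r 1 ^ 2 ≠ 0 := by
    rw [← plane_norm_sq]; exact pow_ne_zero 2 (norm_ne_zero_iff.2 hr)
  rw [plane_inner] at hnr hnw hrw
  have hdet : (n 0 * r 1 - n 1 * r 0) ^ 2 = (n 0 ^ 2 + n 1 ^ 2) * (r 0 ^ 2 + r 1 ^ 2) := by
    linear_combination (-(n 0 * r 0 + n 1 * r 1)) * hnr
  have hdet' : n 0 * r 1 - n 1 * r 0 ≠ 0 := by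
    intro h
    rw [h] at hdet
    exact mul_ne_zero hn' hr' (by rw [← hdet]; ring)
  apply plane_ext
  · refine (mul_eq_zero.1 (?_ : (n 0 * r 1 - n 1 * r 0) * w 0 = 0)).resolve_left hdet'
    linear_combination r 1 * hnw - n 1 * hrw
  · refine (mul_eq_zero.1 (?_ : (n 0 * r 1 - n 1 * r 0) * w 1 = 0)).resolve_left hdet'
    linear_combination n 0 * hrw - r 0 * hnw

/-- Two nonzero vectors orthogonal to a common nonzero vector are parallel. -/
theorem exists_eq_smul_of_inner_eq_zero {n r w : Plane} (hn : n ≠ 0) (hr : r ≠ 0) (hw : w ≠ 0)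
    (hnr : ⟪n, r⟫ = 0) (hnw : ⟪n, w⟫ = 0) : ∃ c : ℝ, c ≠ 0 ∧ w = c • r := by
  have hrr : ⟪r, r⟫ ≠ 0 := inner_self_ne_zero.2 hr
  have h : w = (⟪r, w⟫ / ⟪r, r⟫) • r := by
    rw [← sub_eq_zero]
    apply eq_zero_of_inner_eq_zero_of_inner_eq_zero hn hr hnr
    · rw [inner_sub_right, inner_smul_right, hnr, hnw]; simp
    · rw [inner_sub_right, inner_smul_right, div_mul_cancel₀ _ hrr, sub_self]
  refine ⟨_, ?_, h⟩
  intro h0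
  rw [h0, zero_smul] at h
  exact hw h

theorem exists_ne_zero_inner_eq_zero (r : Plane) : ∃ n : Plane, n ≠ 0 ∧ ⟪n, r⟫ = 0 := by
  by_cases hr : r = 0
  · refine ⟨!₂[1, 0], ?_, by simp [hr]⟩
    intro h
    simpa using congrArg (fun x : Plane => x 0) h
  · refine ⟨!₂[-r 1, r 0], ?_, ?_⟩
    · intro h
      apply hr
      apply plane_ext
      · simpa using congrArg (fun x : Plane => x 1) h
      · simpa using congrArg (fun x : Plane => x 0) h
    · rw [plane_inner]
      simp only [Matrix.cons_val_zero, Matrix.cons_val_one]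
      ring

theorem convex_inner_eq (n : Plane) (κ : ℝ) : Convex ℝ {x : Plane | ⟪n, x⟫ = κ} :=
  convex_hyperplane (innerₛₗ ℝ n).isLinear κ

/-- If a relatively interior point of a segment in a convex set is not an interior point of the
set, then no point of the segment is. -/
theorem Convex.segment_subset_frontier {P : Set Plane} (hP : Convex ℝ P) {a b m : Plane}
    (ha : a ∈ P) (hb : b ∈ P) (hm : m ∈ openSegment ℝ a b) (hmP : m ∉ interior P) :
    segment ℝ a b ⊆ frontier P := by
  intro x hx
  refine ⟨subset_closure (hP.segment_subset ha hb hx), fun hxi => hmP ?_⟩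
  rw [openSegment_eq_image_lineMap] at hm
  rw [segment_eq_image_lineMap] at hx
  obtain ⟨t, ⟨ht0, ht1⟩, rfl⟩ := hm
  obtain ⟨s, ⟨hs0, hs1⟩, rfl⟩ := hx
  simp only [AffineMap.lineMap_apply_module] at *
  rcases lt_trichotomy s t with h | h | h
  · refine hP.openSegment_interior_self_subset_interior hxi hb
      ⟨(1 - t) / (1 - s), (t - s) / (1 - s), div_pos (by linarith) (by linarith),
        div_pos (by linarith) (by linarith), ?_, ?_⟩
    · field_simp [show 1 - s ≠ 0 by linarith]
      ring
    · have : 1 - s ≠ 0 := by linarith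
      match_scalars <;> field_simp
      ring
  · rwa [← h]
  · refine hP.openSegment_interior_self_subset_interior hxi ha
      ⟨t / s, (s - t) / s, div_pos ht0 (by linarith),
        div_pos (by linarith) (by linarith), ?_, ?_⟩
    · field_simp [show s ≠ 0 by linarith]
      ring
    · have : s ≠ 0 := by linarith
      match_scalars <;> field_simp
      ring

/-- A nondegenerate segment in the frontier of a compact convex set extends to an edge, which is
the section of the set by the line carrying the segment. -/
theorem exists_isEdgeOf_of_subset_frontier {P : Set Plane} (hP : Convex ℝ P) (hc : IsCompact P)
    {a b n : Plane} {κ : ℝ} (hab : a ≠ b) (hs : segment ℝ a b ⊆ frontier P) (hn : n ≠ 0)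
    (ha : ⟪n, a⟫ = κ) (hb : ⟪n, b⟫ = κ) :
    ∃ c d, IsEdgeOf P c d ∧ segment ℝ c d = P ∩ {x | ⟪n, x⟫ = κ} := by
  have hfr : frontier P ⊆ P := hc.isClosed.frontier_subset
  have haP : a ∈ P := hfr (hs (left_mem_segment ℝ a b))
  have hbP : b ∈ P := hfr (hs (right_mem_segment ℝ a b))
  set S := P ∩ {x : Plane | ⟪n, x⟫ = κ} with hS
  have hSc : IsCompact S :=
    hc.inter_right (isClosed_eq (by fun_prop) continuous_const)
  have hSconv : Convex ℝ S := hP.inter (convex_inner_eq n κ)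
  have hf : ContinuousOn (fun x : Plane => ⟪b - a, x⟫) S := by fun_prop
  have haS : a ∈ S := ⟨haP, ha⟩
  have hbS : b ∈ S := ⟨hbP, hb⟩
  obtain ⟨c, hcS, hcmin⟩ := hSc.exists_isMinOn ⟨a, haS⟩ hf
  obtain ⟨d, hdS, hdmax⟩ := hSc.exists_isMaxOn ⟨a, haS⟩ hf
  have hab' : 0 < ⟪b - a, b⟫ - ⟪b - a, a⟫ := by
    rw [← inner_sub_right]
    exact real_inner_self_pos.2 (sub_ne_zero.2 hab.symm)
  have hca : ⟪b - a, c⟫ ≤ ⟪b - a, a⟫ := hcmin haS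
  have hbd : ⟪b - a, b⟫ ≤ ⟪b - a, d⟫ := hdmax hbS
  have hcd : 0 < ⟪b - a, d⟫ - ⟪b - a, c⟫ := by linarith
  have hpar (x : Plane) (hx : x ∈ S) :
      x = AffineMap.lineMap c d ((⟪b - a, x⟫ - ⟪b - a, c⟫) / (⟪b - a, d⟫ - ⟪b - a, c⟫)) := by
    rw [← sub_eq_zero]
    have e (z : Plane) (hz : z ∈ S) : ⟪n, z⟫ = κ := hz.2
    apply eq_zero_of_inner_eq_zero_of_inner_eq_zero hn (sub_ne_zero.2 hab.symm)
    · rw [inner_sub_right, ha, hb, sub_self]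
    · rw [AffineMap.lineMap_apply_module']
      simp only [inner_sub_right, inner_add_right, inner_smul_right, e x hx, e c hcS, e d hdS]
      ring
    · rw [AffineMap.lineMap_apply_module']
      simp only [inner_sub_right, inner_add_right, inner_smul_right]
      rw [div_mul_cancel₀ _ hcd.ne']
      ring
  have hsub : S ⊆ segment ℝ c d := by
    intro x hx
    rw [hpar x hx, segment_eq_image_lineMap]
    have h1 : ⟪b - a, c⟫ ≤ ⟪b - a, x⟫ := hcmin hx
    have h2 : ⟪b - a, x⟫ ≤ ⟪b - a, d⟫ := hdmax hx
    exact ⟨_, ⟨div_nonneg (by linarith) hcd.le, (div_le_one hcd).2 (by linarith)⟩, rfl⟩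
  have heq : segment ℝ c d = S := (hSconv.segment_subset hcS hdS).antisymm hsub
  have hne : c ≠ d := by
    rintro rfl
    simp at hcd
  refine ⟨c, d, ⟨hne, ?_, ?_⟩, heq⟩
  · have hmS : midpoint ℝ a b ∈ S := hSconv.segment_subset haS hbS (midpoint_mem_segment a b)
    have hmf : ⟪b - a, midpoint ℝ a b⟫ = (⟪b - a, a⟫ + ⟪b - a, b⟫) / 2 := by
      rw [midpoint_eq_smul_add, inner_smul_right, inner_add_right, invOf_eq_inv]
      ring
    refine hP.segment_subset_frontier hcS.1 hdS.1 (m := midpoint ℝ a b) ?_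
      (hs (midpoint_mem_segment a b)).2
    rw [hpar _ hmS, openSegment_eq_image_lineMap]
    exact ⟨_, ⟨div_pos (by linarith) hcd, (div_lt_one hcd).2 (by linarith)⟩, rfl⟩
  · intro c' d' hsup hfr'
    refine Set.Subset.antisymm ?_ hsup
    rw [heq]
    have hc' := hsup (left_mem_segment ℝ c d)
    have hd' := hsup (right_mem_segment ℝ c d)
    rw [segment_eq_image_lineMap] at hc' hd'
    obtain ⟨s, -, hs⟩ := hc'
    obtain ⟨t, -, ht⟩ := hd'
    have hst : s - t ≠ 0 := by
      rw [sub_ne_zero]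
      rintro rfl
      exact hne (hs.symm.trans ht)
    have hs' : ⟪n, c'⟫ + s * (⟪n, d'⟫ - ⟪n, c'⟫) = κ := by
      rw [← (hcS.2 : ⟪n, c⟫ = κ), ← hs, AffineMap.lineMap_apply_module']
      simp only [inner_sub_right, inner_add_right, inner_smul_right]
      ring
    have ht' : ⟪n, c'⟫ + t * (⟪n, d'⟫ - ⟪n, c'⟫) = κ := by
      rw [← (hdS.2 : ⟪n, d⟫ = κ), ← ht, AffineMap.lineMap_apply_module']
      simp only [inner_sub_right, inner_add_right, inner_smul_right]
      ring
    have hz : ⟪n, d'⟫ - ⟪n, c'⟫ = 0 :=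
      (mul_eq_zero.1 (by linear_combination hs' - ht')).resolve_left hst
    rw [hz, mul_zero, add_zero] at hs'
    refine hSconv.segment_subset ⟨hfr (hfr' (left_mem_segment ℝ c' d')), hs'⟩
      ⟨hfr (hfr' (right_mem_segment ℝ c' d')), ?_⟩
    show ⟪n, d'⟫ = κ
    linarith

theorem IsEdgeOf.segment_eq {P : Set Plane} (hP : Convex ℝ P) (hc : IsCompact P)
    {a b n : Plane} {κ : ℝ} (he : IsEdgeOf P a b) (hn : n ≠ 0)
    (ha : ⟪n, a⟫ = κ) (hb : ⟪n, b⟫ = κ) : segment ℝ a b = P ∩ {x | ⟪n, x⟫ = κ} := by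
  obtain ⟨c, d, hcd, heq⟩ :=
    exists_isEdgeOf_of_subset_frontier hP hc he.1 he.2.1 hn ha hb
  have hsub : segment ℝ a b ⊆ segment ℝ c d := by
    rw [heq]
    exact Set.subset_inter (he.2.1.trans hc.isClosed.frontier_subset)
      ((convex_inner_eq n κ).segment_subset ha hb)
  rw [← heq, he.2.2 c d hsub hcd.2.1]

/-- Every nondegenerate segment in the frontier is contained in an edge of the same direction. -/
theorem exists_isEdgeOf_superset {P : Set Plane} (hP : Convex ℝ P) (hc : IsCompact P)
    {a b : Plane} (hab : a ≠ b) (hs : segment ℝ a b ⊆ frontier P) :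
    ∃ c d, IsEdgeOf P c d ∧ segment ℝ a b ⊆ segment ℝ c d ∧
      ∃ r : ℝ, r ≠ 0 ∧ b - a = r • (d - c) := by
  obtain ⟨n, hn, hnr⟩ := exists_ne_zero_inner_eq_zero (b - a)
  have hb : ⟪n, b⟫ = ⟪n, a⟫ := by rwa [inner_sub_right, sub_eq_zero] at hnr
  obtain ⟨c, d, hcd, heq⟩ := exists_isEdgeOf_of_subset_frontier hP hc hab hs hn rfl hb
  refine ⟨c, d, hcd, ?_, ?_⟩
  · rw [heq]
    exact Set.subset_inter (hs.trans hc.isClosed.frontier_subset)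
      ((convex_inner_eq n _).segment_subset rfl hb)
  · have h1 : ⟪n, c⟫ = ⟪n, a⟫ := (heq.subset (left_mem_segment ℝ c d)).2
    have h2 : ⟪n, d⟫ = ⟪n, a⟫ := (heq.subset (right_mem_segment ℝ c d)).2
    exact exists_eq_smul_of_inner_eq_zero hn (sub_ne_zero.2 hcd.1.symm)
      (sub_ne_zero.2 hab.symm) (by rw [inner_sub_right, h1, h2, sub_self]) hnr

theorem convex_unitSquare : Convex ℝ unitSquare := by
  intro x hx y hy s t hs ht hst
  constructor
  · exact convex_Icc (0 : ℝ) 1 hx.1 hy.1 hs ht hst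
  · exact convex_Icc (0 : ℝ) 1 hx.2 hy.2 hs ht hst

theorem isCompact_unitSquare : IsCompact unitSquare := by
  refine Metric.isCompact_of_isClosed_isBounded ?_ ?_
  · exact (isClosed_Icc.preimage (f := fun x : Plane => x 0) (by fun_prop)).inter
      (isClosed_Icc.preimage (f := fun x : Plane => x 1) (by fun_prop))
  · rw [isBounded_iff_forall_norm_le]
    refine ⟨2, fun x hx => ?_⟩
    have h := plane_norm_sq x
    obtain ⟨⟨h1, h2⟩, h3, h4⟩ := hx
    refine abs_le_of_sq_le_sq' ?_ zero_le_two |>.2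
    nlinarith

theorem eq_zero_or_one_of_mem_frontier_unitSquare {p : Plane} (hp : p ∈ frontier unitSquare) :
    p 0 = 0 ∨ p 0 = 1 ∨ p 1 = 0 ∨ p 1 = 1 := by
  by_contra! h
  obtain ⟨h0, h1, h2, h3⟩ := h
  obtain ⟨⟨i0, i1⟩, i2, i3⟩ := isCompact_unitSquare.isClosed.frontier_subset hp
  refine hp.2 (mem_interior.2 ⟨{x | x 0 ∈ Set.Ioo (0 : ℝ) 1 ∧ x 1 ∈ Set.Ioo (0 : ℝ) 1}, ?_, ?_, ?_⟩)
  · exact fun x hx => ⟨Set.Ioo_subset_Icc_self hx.1, Set.Ioo_subset_Icc_self hx.2⟩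
  · exact (isOpen_Ioo.preimage (f := fun x : Plane => x 0) (by fun_prop)).inter
      (isOpen_Ioo.preimage (f := fun x : Plane => x 1) (by fun_prop))
  · exact ⟨⟨lt_of_le_of_ne i0 h0.symm, lt_of_le_of_ne i1 h1⟩,
      ⟨lt_of_le_of_ne i2 h2.symm, lt_of_le_of_ne i3 h3⟩⟩

theorem stdVec_zero_ne_zero : (!₂[1, 0] : Plane) ≠ 0 := fun h => by
  simpa using congrArg (fun x : Plane => x 0) h

theorem stdVec_one_ne_zero : (!₂[0, 1] : Plane) ≠ 0 := fun h => by
  simpa using congrArg (fun x : Plane => x 1) h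

theorem IsEdgeOf.unitSquare_cases {a b : Plane} (h : IsEdgeOf unitSquare a b) :
    ((segment ℝ a b = leftSide ∨ segment ℝ a b = rightSide) ∧ b 0 = a 0) ∨
    ((segment ℝ a b = bottomSide ∨ segment ℝ a b = topSide) ∧ b 1 = a 1) := by
  have hfr := isCompact_unitSquare.isClosed.frontier_subset
  obtain ⟨⟨a0, a1⟩, a2, a3⟩ := hfr (h.2.1 (left_mem_segment ℝ a b))
  obtain ⟨⟨b0, b1⟩, b2, b3⟩ := hfr (h.2.1 (right_mem_segment ℝ a b))
  have hm := eq_zero_or_one_of_mem_frontier_unitSquare (h.2.1 (midpoint_mem_segment a b))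
  have hmid (i : Fin 2) : midpoint ℝ a b i = (a i + b i) / 2 := by
    rw [midpoint_eq_smul_add]
    simp
    ring
  simp only [hmid] at hm
  have key0 (κ : ℝ) (ha : a 0 = κ) (hb : b 0 = κ) :
      segment ℝ a b = {x ∈ unitSquare | x 0 = κ} := by
    rw [h.segment_eq convex_unitSquare isCompact_unitSquare (κ := κ) stdVec_zero_ne_zero
      (by simpa [plane_inner] using ha) (by simpa [plane_inner] using hb)]
    ext x
    simp [plane_inner]
  have key1 (κ : ℝ) (ha : a 1 = κ) (hb : b 1 = κ) :
      segment ℝ a b = {x ∈ unitSquare | x 1 = κ} := by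
    rw [h.segment_eq convex_unitSquare isCompact_unitSquare (κ := κ) stdVec_one_ne_zero
      (by simpa [plane_inner] using ha) (by simpa [plane_inner] using hb)]
    ext x
    simp [plane_inner]
  rcases hm with hm | hm | hm | hm
  · exact Or.inl ⟨Or.inl (key0 0 (by linarith) (by linarith)), by linarith⟩
  · exact Or.inl ⟨Or.inr (key0 1 (by linarith) (by linarith)), by linarith⟩
  · exact Or.inr ⟨Or.inl (key1 0 (by linarith) (by linarith)), by linarith⟩
  · exact Or.inr ⟨Or.inr (key1 1 (by linarith) (by linarith)), by linarith⟩

theorem separatedPolygon_unitSquare : SeparatedPolygon (π / 6) unitSquare := by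
  refine ⟨subset_rfl, fun a b a' b' h h' hne => ?_⟩
  rcases h.unitSquare_cases with ⟨h1 | h1, h2⟩ | ⟨h1 | h1, h2⟩ <;>
  rcases h'.unitSquare_cases with ⟨h3 | h3, h4⟩ | ⟨h3 | h3, h4⟩ <;>
  first
  | exact absurd (h1.trans h3.symm) hne
  | (rw [h1, h3]; simp only [subset_refl, and_self, true_or, or_true]; done)
  | (left
     rw [lineAngle_eq_pi_div_two_of_inner_eq_zero (by
       rw [plane_inner]; simp only [PiLp.sub_apply, h2, h4, sub_self, zero_mul, mul_zero, add_zero])]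
     linarith [Real.pi_pos])

/-- The properties of the polygons of the angular method maintained by the recursion: besides
being separated, a polygon of level `k` has at most `k + 2` edge directions and its frontier is
covered by finitely many supporting lines. -/
structure AngularInvariant (k : ℕ) (P : Set Plane) : Prop where
  convex : Convex ℝ P
  isCompact : IsCompact P
  separated : SeparatedPolygon (π / (2 * (k : ℝ) + 6)) P
  directions : ∃ T : Finset Plane, T.card ≤ k + 2 ∧
    ∀ a b, IsEdgeOf P a b → ∃ e ∈ T, ∃ r : ℝ, r ≠ 0 ∧ b - a = r • e
  support : ∃ S : Set (Plane × ℝ), S.Finite ∧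
    ∀ p ∈ frontier P, ∃ h ∈ S, h.1 ≠ 0 ∧ ⟪h.1, p⟫ = h.2 ∧ ∀ x ∈ P, ⟪h.1, x⟫ ≤ h.2

theorem angularInvariant_unitSquare : AngularInvariant 0 unitSquare where
  convex := convex_unitSquare
  isCompact := isCompact_unitSquare
  separated := by simpa using separatedPolygon_unitSquare
  directions := by
    classical
    refine ⟨{!₂[1, 0], !₂[0, 1]}, Finset.card_le_two, fun a b h => ?_⟩
    have hne := h.1
    rcases h.unitSquare_cases with ⟨-, h⟩ | ⟨-, h⟩
    · refine ⟨!₂[0, 1], by simp, b 1 - a 1, ?_, ?_⟩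
      · intro h'
        exact hne (plane_ext h.symm (by linarith))
      · apply plane_ext <;> simp [h]
    · refine ⟨!₂[1, 0], by simp, b 0 - a 0, ?_, ?_⟩
      · intro h'
        exact hne (plane_ext (by linarith) h.symm)
      · apply plane_ext <;> simp [h]
  support := by
    refine ⟨{(-!₂[1, 0], 0), (!₂[1, 0], 1), (-!₂[0, 1], 0), (!₂[0, 1], 1)},
      by simp, fun p hp => ?_⟩
    rcases eq_zero_or_one_of_mem_frontier_unitSquare hp with h | h | h | h
    · exact ⟨(-!₂[1, 0], 0), by simp, neg_ne_zero.2 stdVec_zero_ne_zero,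
        by simp [plane_inner, h], fun x hx => by simpa [plane_inner] using hx.1.1⟩
    · exact ⟨(!₂[1, 0], 1), by simp, stdVec_zero_ne_zero,
        by simp [plane_inner, h], fun x hx => by simpa [plane_inner] using hx.1.2⟩
    · exact ⟨(-!₂[0, 1], 0), by simp, neg_ne_zero.2 stdVec_one_ne_zero,
        by simp [plane_inner, h], fun x hx => by simpa [plane_inner] using hx.2.1⟩
    · exact ⟨(!₂[0, 1], 1), by simp, stdVec_one_ne_zero,
        by simp [plane_inner, h], fun x hx => by simpa [plane_inner] using hx.2.2⟩

theorem minEdgeAngle_le {P : Set Plane} {a b : Plane} (h : IsEdgeOf P a b) (v : Plane) :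
    minEdgeAngle P v ≤ lineAngle v (b - a) := by
  refine csInf_le ⟨0, ?_⟩ ⟨a, b, h, rfl⟩
  rintro _ ⟨a, b, -, rfl⟩
  exact lineAngle_nonneg _ _

/-- The direction chosen by the angular method makes a large angle with every edge. -/
theorem AngularInvariant.le_lineAngle {k : ℕ} {P : Set Plane} (hP : AngularInvariant k P)
    {u : Plane} (hu : IsAngularBestDir P u) {a b : Plane} (h : IsEdgeOf P a b) :
    π / (2 * (k : ℝ) + 6) ≤ lineAngle u (b - a) := by
  obtain ⟨T, hT, hdir⟩ := hP.directions
  obtain ⟨v, hv, hvT⟩ := exists_direction_lineAngle_ge T hT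
  refine le_trans ?_ ((hu.2 v hv).trans (minEdgeAngle_le h u))
  refine le_csInf ⟨_, a, b, h, rfl⟩ ?_
  rintro _ ⟨c, d, hcd, rfl⟩
  obtain ⟨e, he, r, hr, heq⟩ := hdir c d hcd
  rw [heq, lineAngle_smul_right hr]
  have hk : 2 * (k : ℝ) + 6 = 2 * (((k + 2 : ℕ) : ℝ) + 1) := by
    push_cast
    ring
  exact hk ▸ hvT e he

theorem mem_frontier_inter_halfspace {P : Set Plane} (hc : IsClosed P) {n p : Plane} {κ : ℝ}
    (hp : p ∈ frontier (P ∩ {x | ⟪n, x⟫ ≤ κ})) : ⟪n, p⟫ = κ ∨ p ∈ frontier P := by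
  have hcl : IsClosed (P ∩ {x | ⟪n, x⟫ ≤ κ}) :=
    hc.inter (isClosed_le (by fun_prop) continuous_const)
  obtain ⟨hpP, hpn⟩ := hcl.frontier_subset hp
  by_contra! h
  have hint : p ∈ interior P := by
    by_contra hni
    exact h.2 ⟨subset_closure hpP, hni⟩
  have hopen : IsOpen {x : Plane | ⟪n, x⟫ < κ} := isOpen_lt (by fun_prop) continuous_const
  refine hp.2 (mem_interior.2 ⟨interior P ∩ {x | ⟪n, x⟫ < κ}, ?_, isOpen_interior.inter hopen,
    hint, lt_of_le_of_ne hpn h.1⟩)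
  exact fun x hx => ⟨interior_subset hx.1, show ⟪n, x⟫ ≤ κ from (show ⟪n, x⟫ < κ from hx.2).le⟩

/-- An edge of a convex set cut by a half-plane either lies on the cutting line or is contained in
an edge of the original set. -/
theorem IsEdgeOf.of_inter_halfspace {P : Set Plane} (hP : Convex ℝ P) (hc : IsCompact P)
    {n : Plane} {κ : ℝ} {a b : Plane} (h : IsEdgeOf (P ∩ {x | ⟪n, x⟫ ≤ κ}) a b) :
    (⟪n, a⟫ = κ ∧ ⟪n, b⟫ = κ) ∨
    ∃ c d, IsEdgeOf P c d ∧ segment ℝ a b ⊆ segment ℝ c d ∧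
      ∃ r : ℝ, r ≠ 0 ∧ b - a = r • (d - c) := by
  have hcl : IsClosed (P ∩ {x | ⟪n, x⟫ ≤ κ}) :=
    hc.isClosed.inter (isClosed_le (by fun_prop) continuous_const)
  obtain ⟨haP, han⟩ := hcl.frontier_subset (h.2.1 (left_mem_segment ℝ a b))
  obtain ⟨hbP, hbn⟩ := hcl.frontier_subset (h.2.1 (right_mem_segment ℝ a b))
  simp only [Set.mem_ofPred_eq] at han hbn
  rcases mem_frontier_inter_halfspace hc.isClosed (h.2.1 (midpoint_mem_segment a b)) with hm | hm
  · left
    rw [midpoint_eq_smul_add, inner_smul_right, inner_add_right, invOf_eq_inv] at hm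
    constructor <;> linarith
  · right
    exact exists_isEdgeOf_superset hP hc h.1 (hP.segment_subset_frontier haP hbP
      (midpoint_mem_openSegment a b) hm.2)

theorem AngularInvariant.inter_halfspace {k : ℕ} {P : Set Plane} (hP : AngularInvariant k P)
    {u : Plane} (hu : IsAngularBestDir P u) {n : Plane} {κ : ℝ} (hn : n ≠ 0) (hun : ⟪u, n⟫ = 0) :
    AngularInvariant (k + 1) (P ∩ {x | ⟪n, x⟫ ≤ κ}) := by
  have hnu : ⟪n, u⟫ = 0 := by rwa [real_inner_comm]
  have hconv : Convex ℝ (P ∩ {x | ⟪n, x⟫ ≤ κ}) :=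
    hP.convex.inter (convex_halfSpace_le (innerₛₗ ℝ n).isLinear κ)
  have hcomp : IsCompact (P ∩ {x | ⟪n, x⟫ ≤ κ}) :=
    hP.isCompact.inter_right (isClosed_le (by fun_prop) continuous_const)
  have hφ : π / (2 * ((k + 1 : ℕ) : ℝ) + 6) ≤ π / (2 * (k : ℝ) + 6) := by
    push_cast
    gcongr
    linarith
  have hnew (a b : Plane) (hab : a ≠ b) (ha : ⟪n, a⟫ = κ) (hb : ⟪n, b⟫ = κ) :
      ∃ r : ℝ, r ≠ 0 ∧ b - a = r • u :=
    exists_eq_smul_of_inner_eq_zero hn hu.1 (sub_ne_zero.2 hab.symm) hnu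
      (by rw [inner_sub_right, ha, hb, sub_self])
  refine ⟨hconv, hcomp, ⟨Set.inter_subset_left.trans hP.separated.1, ?_⟩, ?_, ?_⟩
  · intro a b a' b' h h' hne
    rcases h.of_inter_halfspace hP.convex hP.isCompact with ⟨ha, hb⟩ | ⟨c, d, hcd, hsub, r, hr, hdir⟩
    · rcases h'.of_inter_halfspace hP.convex hP.isCompact with
        ⟨ha', hb'⟩ | ⟨c', d', hcd', hsub', r', hr', hdir'⟩
      · exact absurd ((h.segment_eq hconv hcomp hn ha hb).trans
          (h'.segment_eq hconv hcomp hn ha' hb').symm) hne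
      · obtain ⟨s, hs, hs'⟩ := hnew a b h.1 ha hb
        left
        rw [hs', hdir', lineAngle_smul_left hs, lineAngle_smul_right hr']
        exact hφ.trans (hP.le_lineAngle hu hcd')
    · rcases h'.of_inter_halfspace hP.convex hP.isCompact with
        ⟨ha', hb'⟩ | ⟨c', d', hcd', hsub', r', hr', hdir'⟩
      · obtain ⟨s, hs, hs'⟩ := hnew a' b' h'.1 ha' hb'
        left
        rw [hs', hdir, lineAngle_smul_left hr, lineAngle_smul_right hs, lineAngle_comm]
        exact hφ.trans (hP.le_lineAngle hu hcd)
      · have hne' : segment ℝ c d ≠ segment ℝ c' d' := by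
          intro heq
          obtain ⟨m, hm, hm'⟩ := exists_ne_zero_inner_eq_zero (d - c)
          have hm' : ⟪m, d⟫ = ⟪m, c⟫ := by rwa [inner_sub_right, sub_eq_zero] at hm'
          have hon (x : Plane) (hx : x ∈ segment ℝ c d) : ⟪m, x⟫ = ⟪m, c⟫ :=
            (convex_inner_eq m _).segment_subset rfl hm' hx
          apply hne
          rw [h.segment_eq hconv hcomp hm (hon a (hsub (left_mem_segment ℝ a b)))
              (hon b (hsub (right_mem_segment ℝ a b))),
            h'.segment_eq hconv hcomp hm
              (hon a' (heq ▸ hsub' (left_mem_segment ℝ a' b')))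
              (hon b' (heq ▸ hsub' (right_mem_segment ℝ a' b')))]
        rw [hdir, hdir', lineAngle_smul_left hr, lineAngle_smul_right hr']
        exact (hP.separated.2 c d c' d' hcd hcd' hne').imp hφ.trans
          (Or.imp (And.imp hsub.trans hsub'.trans) (Or.imp (And.imp hsub.trans hsub'.trans)
            (Or.imp (And.imp hsub.trans hsub'.trans) (And.imp hsub.trans hsub'.trans))))
  · classical
    obtain ⟨T, hT, hdirs⟩ := hP.directions
    refine ⟨insert u T, (Finset.card_insert_le _ _).trans (by omega), fun a b h => ?_⟩
    rcases h.of_inter_halfspace hP.convex hP.isCompact with ⟨ha, hb⟩ | ⟨c, d, hcd, -, r, hr, hdir⟩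
    · exact ⟨u, Finset.mem_insert_self _ _, hnew a b h.1 ha hb⟩
    · obtain ⟨e, he, s, hs, heq⟩ := hdirs c d hcd
      exact ⟨e, Finset.mem_insert_of_mem he, r * s, mul_ne_zero hr hs,
        by rw [hdir, heq, smul_smul]⟩
  · obtain ⟨S, hS, hsupp⟩ := hP.support
    refine ⟨insert (n, κ) S, hS.insert _, fun p hp => ?_⟩
    rcases mem_frontier_inter_halfspace hP.isCompact.isClosed hp with h | h
    · exact ⟨(n, κ), Set.mem_insert _ _, hn, h, fun x hx => hx.2⟩
    · obtain ⟨g, hg, hg0, hgp, hgP⟩ := hsupp p h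
      exact ⟨g, Set.mem_insert_of_mem _ hg, hg0, hgp, fun x hx => hgP x hx.1⟩

theorem AngularInvariant.of_isCutPiece {k : ℕ} {P Q : Set Plane} (hP : AngularInvariant k P)
    {u : Plane} (hu : IsAngularBestDir P u) (hQ : IsCutPiece P Q u) :
    AngularInvariant (k + 1) Q := by
  obtain ⟨n, κ, hn, hun, rfl | rfl⟩ := hQ
  · exact hP.inter_halfspace hu hn hun
  · have := hP.inter_halfspace hu (κ := -κ) (neg_ne_zero.2 hn) (by rw [inner_neg_right, hun, neg_zero])
    simpa only [inner_neg_left, neg_le_neg_iff] using this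

theorem volume_unitSquare : volume unitSquare = 1 := by
  have h : unitSquare = (WithLp.ofLp : Plane → Fin 2 → ℝ) ⁻¹' Set.Icc 0 1 := by
    ext x
    simp [unitSquare, Set.mem_Icc, Pi.le_def, Fin.forall_fin_two]
    tauto
  rw [h, (PiLp.volume_preserving_ofLp (Fin 2)).measure_preimage
    measurableSet_Icc.nullMeasurableSet, Real.volume_Icc_pi]
  simp

/-- The area of a planar convex set containing a triangle, bounded below through an inscribed
parallelogram. -/
theorem le_volume_of_triangle {P : Set Plane} (hP : Convex ℝ P) (hc : IsCompact P)
    {a b z : Plane} (ha : a ∈ P) (hb : b ∈ P) (hz : z ∈ P) :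
    |(b 0 - a 0) * (z 1 - a 1) - (b 1 - a 1) * (z 0 - a 0)| / 4 ≤ (volume P).toReal := by
  let M : Matrix (Fin 2) (Fin 2) ℝ :=
    !![(b 0 - a 0) / 2, (z 0 - a 0) / 2; (b 1 - a 1) / 2, (z 1 - a 1) / 2]
  let L : Plane →ₗ[ℝ] Plane := Matrix.toLpLin 2 2 M
  have hL (x : Plane) : L x = (x 0 / 2) • (b - a) + (x 1 / 2) • (z - a) := by
    apply plane_ext <;>
    · simp [L, M, Matrix.toLpLin_apply, dotProduct, Fin.sum_univ_two]
      ring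
  have hdet : LinearMap.det L =
      ((b 0 - a 0) * (z 1 - a 1) - (b 1 - a 1) * (z 0 - a 0)) / 4 := by
    have : L = Matrix.toLin (PiLp.basisFun 2 ℝ (Fin 2)) (PiLp.basisFun 2 ℝ (Fin 2)) M :=
      by rw [← Matrix.toLpLin_eq_toLin]
    rw [this, LinearMap.det_toLin, Matrix.det_fin_two]
    simp only [M, Matrix.of_apply, Matrix.cons_val', Matrix.cons_val_zero, Matrix.cons_val_one,
      Matrix.cons_val_fin_one]
    ring
  have hsub : L '' unitSquare ⊆ (fun x => a + x) ⁻¹' P := by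
    rintro _ ⟨x, ⟨⟨h0, h1⟩, h2, h3⟩, rfl⟩
    have := hP.sum_mem (t := Finset.univ) (w := ![1 - x 0 / 2 - x 1 / 2, x 0 / 2, x 1 / 2])
      (z := ![a, b, z])
    simp only [Fin.forall_fin_succ, Fin.sum_univ_three] at this
    simp only [Set.mem_preimage, hL]
    convert this ?_ ?_ ?_ using 1
    · simp
      module
    · simp
      exact ⟨by linarith, by linarith, by linarith⟩
    · simp
      ring
    · simp [ha, hb, hz]
  have hvol := measure_mono (μ := (volume : Measure Plane)) hsub
  rw [measure_preimage_add, Measure.addHaar_image_linearMap, volume_unitSquare, mul_one, hdet,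
    abs_div] at hvol
  have := (ENNReal.ofReal_le_iff_le_toReal hc.measure_lt_top.ne).1 hvol
  simpa using this

theorem exists_pos_add_smul_mem {P : Set Plane} {m : Plane} (hm : m ∈ interior P) (v : Plane) :
    ∃ ε : ℝ, 0 < ε ∧ m + ε • v ∈ P := by
  have hcont : Filter.Tendsto (fun t : ℝ => m + t • v) (nhdsWithin 0 (Set.Ioi 0)) (nhds m) := by
    have : Continuous (fun t : ℝ => m + t • v) := by fun_prop
    simpa using (this.tendsto 0).mono_left nhdsWithin_le_nhds
  obtain ⟨ε, h1, h2⟩ :=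
    ((hcont.eventually (mem_interior_iff_mem_nhds.1 hm)).and self_mem_nhdsWithin).exists
  exact ⟨ε, h2, h1⟩

theorem exists_inner_ne_zero_of_volume_ne_zero {P : Set Plane} (hP : volume P ≠ 0) {n : Plane}
    (hn : n ≠ 0) (a : Plane) : ∃ z ∈ P, ⟪n, z - a⟫ ≠ 0 := by
  by_contra! h
  apply hP
  let A : AffineSubspace ℝ Plane := AffineSubspace.mk' a (LinearMap.ker (innerₛₗ ℝ n))
  have hA : A ≠ ⊤ := by
    intro hA
    have : n + a ∈ A := hA ▸ AffineSubspace.mem_top ℝ Plane _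
    rw [AffineSubspace.mem_mk'] at this
    simp [hn] at this
  refine measure_mono_null (fun x hx => ?_) (Measure.addHaar_affineSubspace volume A hA)
  show x ∈ A
  rw [AffineSubspace.mem_mk']
  simpa using h x hx

/-- Coordinates with respect to two orthogonal vectors of equal length. -/
theorem inner_mul_inner_eq {r n : Plane} (hr : r ≠ 0) (hnr : ⟪n, r⟫ = 0)
    (hnn : ⟪n, n⟫ = ⟪r, r⟫) (g x : Plane) :
    ⟪r, r⟫ * ⟪g, x⟫ = ⟪g, r⟫ * ⟪r, x⟫ + ⟪g, n⟫ * ⟪n, x⟫ := by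
  have hn : n ≠ 0 := by
    rintro rfl
    rw [inner_zero_left] at hnn
    exact inner_self_ne_zero.2 hr hnn.symm
  have h : ⟪r, r⟫ • x - ⟪r, x⟫ • r - ⟪n, x⟫ • n = 0 := by
    have hrn : ⟪r, n⟫ = 0 := by rwa [real_inner_comm]
    apply eq_zero_of_inner_eq_zero_of_inner_eq_zero hn hr hnr
    · simp only [inner_sub_right, inner_smul_right, hnr, hnn]
      ring
    · simp only [inner_sub_right, inner_smul_right, hrn]
      ring
  have := congrArg (fun y => ⟪g, y⟫) h
  simp only [inner_sub_right, inner_smul_right, inner_zero_right] at this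
  linarith

/-- Let `a`, `b` be points of a convex polygon, `r = b - a`, and let `n` be `r` rotated by a right
angle. On the side of the polygon in the direction `n` there is an edge whose middle part (with
respect to `r`) is nondegenerate, so that its slope is bounded by the height of the polygon. -/
theorem exists_edge_over_middle {P : Set Plane} (hP : Convex ℝ P) (hc : IsCompact P)
    {S : Set (Plane × ℝ)} (hS : S.Finite)
    (hsupp : ∀ p ∈ frontier P,
      ∃ h ∈ S, h.1 ≠ 0 ∧ ⟪h.1, p⟫ = h.2 ∧ ∀ x ∈ P, ⟪h.1, x⟫ ≤ h.2)
    {a r n z : Plane} {W : ℝ} (ha : a ∈ P) (hb : a + r ∈ P) (hz : z ∈ P) (hr : r ≠ 0)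
    (hnr : ⟪n, r⟫ = 0) (hnn : ⟪n, n⟫ = ⟪r, r⟫) (hW : ∀ x ∈ P, |⟪n, x - a⟫| ≤ W)
    (hzn : ⟪n, z - a⟫ ≠ 0) :
    ∃ c d p p' g : Plane, IsEdgeOf P c d ∧ p ∈ segment ℝ c d ∧ p' ∈ segment ℝ c d ∧
      ⟪r, r⟫ / 3 ≤ ⟪r, p - a⟫ ∧ ⟪r, p - a⟫ ≤ 2 * ⟪r, r⟫ / 3 ∧
      ⟪r, p' - p⟫ ≠ 0 ∧ |⟪n, p' - p⟫| * ⟪r, r⟫ ≤ 3 * W * |⟪r, p' - p⟫| ∧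
      (∃ t : ℝ, t ≠ 0 ∧ d - c = t • (p' - p)) ∧
      0 < ⟪g, n⟫ ∧ (∀ x ∈ P, ⟪g, x⟫ ≤ ⟪g, p⟫) ∧ ⟪g, p'⟫ = ⟪g, p⟫ := by
  set D := ⟪r, r⟫ with hD
  have hD0 : 0 < D := real_inner_self_pos.2 hr
  have hrn : ⟪r, n⟫ = 0 := by rwa [real_inner_comm]
  have hcoord := inner_mul_inner_eq hr hnr hnn
  have hsec : ∀ s ∈ Set.Icc (D / 3) (2 * D / 3), ∃ p ∈ P, ⟪r, p - a⟫ = s ∧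
      ∀ x ∈ P, ⟪r, x - a⟫ = s → ⟪n, x - a⟫ ≤ ⟪n, p - a⟫ := by
    rintro s ⟨hs1, hs2⟩
    have hcomp : IsCompact (P ∩ {x | ⟪r, x - a⟫ = s}) :=
      hc.inter_right (isClosed_eq (by fun_prop) continuous_const)
    have hmem : a + (s / D) • r ∈ P ∩ {x | ⟪r, x - a⟫ = s} := by
      refine ⟨?_, ?_⟩
      · have : (1 - s / D) • a + (s / D) • (a + r) ∈ P := by
          apply hP ha hb
          · rw [sub_nonneg, div_le_one hD0]; linarith
          · exact div_nonneg (by linarith) hD0.le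
          · ring
        convert this using 1
        module
      · show ⟪r, a + (s / D) • r - a⟫ = s
        rw [add_sub_cancel_left, inner_smul_right, ← hD]
        field_simp
    obtain ⟨p, hp, hmax⟩ := hcomp.exists_isMaxOn (f := fun x => ⟪n, x - a⟫) ⟨_, hmem⟩
      (by fun_prop)
    exact ⟨p, hp.1, hp.2, fun x hx hxs => hmax ⟨hx, hxs⟩⟩
  choose! p hpP hpr hpmax using hsec
  have hpfr : ∀ s ∈ Set.Icc (D / 3) (2 * D / 3), p s ∈ frontier P := by
    intro s hs
    refine ⟨subset_closure (hpP s hs), fun hint => ?_⟩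
    obtain ⟨ε, hε, hεP⟩ := exists_pos_add_smul_mem hint n
    have h1 := hpmax s hs _ hεP (by
      rw [add_sub_right_comm, inner_add_right, hpr s hs, inner_smul_right, hrn]; ring)
    rw [add_sub_right_comm, inner_add_right, inner_smul_right, hnn] at h1
    have : 0 < ε * D := mul_pos hε hD0
    linarith
  choose! h hhS hh0 hhp hhP using hsupp
  have hinf : (Set.Icc (D / 3) (2 * D / 3)).Infinite := Set.Icc_infinite (by linarith)
  obtain ⟨s, hs, s', hs', hne, heq⟩ := hinf.exists_ne_map_eq_of_mapsTo
    (f := fun s => h (p s)) (t := S) (fun s hs => hhS _ (hpfr s hs)) hS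
  replace heq : h (p s) = h (p s') := heq
  have hg0 := hh0 _ (hpfr s hs)
  have hgp := hhp _ (hpfr s hs)
  have hgP := hhP _ (hpfr s hs)
  have hgp' := hhp _ (hpfr s' hs')
  rw [← heq] at hgp'
  have hrs := hpr s hs
  have hrs' := hpr s' hs'
  have hmax := hpmax s hs
  have hqP := hpP s hs
  have hqP' := hpP s' hs'
  generalize p s = q at *
  generalize p s' = q' at *
  generalize (h q).2 = κ at *
  generalize (h q).1 = g at *
  have hΔ : ⟪r, q' - q⟫ = s' - s := by
    rw [← hrs, ← hrs', ← inner_sub_right, sub_sub_sub_cancel_right]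
  have hqq : q ≠ q' := by
    rintro rfl
    exact hne (hrs.symm.trans hrs')
  have hmid : midpoint ℝ q q' ∉ interior P := by
    intro hint
    obtain ⟨ε, hε, hεP⟩ := exists_pos_add_smul_mem hint g
    have h1 := hgP _ hεP
    rw [midpoint_eq_smul_add, inner_add_right, inner_smul_right, inner_smul_right, inner_add_right,
      hgp, hgp', invOf_eq_inv] at h1
    have : 0 < ε * ⟪g, g⟫ := mul_pos hε (real_inner_self_pos.2 hg0)
    linarith
  obtain ⟨c, d, hcd, hseg⟩ := exists_isEdgeOf_of_subset_frontier hP hc hqq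
    (hP.segment_subset_frontier hqP hqP' (midpoint_mem_openSegment q q') hmid) hg0 hgp hgp'
  have hcκ : ⟪g, c⟫ = κ := (hseg.subset (left_mem_segment ℝ c d)).2
  have hdκ : ⟪g, d⟫ = κ := (hseg.subset (right_mem_segment ℝ c d)).2
  -- the slope of the supporting line in the coordinates given by `r` and `n`
  set α := ⟪g, r⟫ with hα
  set β := ⟪g, n⟫ with hβ
  have hline (x : Plane) : D * (⟪g, x⟫ - ⟪g, a⟫) = α * ⟪r, x - a⟫ + β * ⟪n, x - a⟫ := by
    rw [← inner_sub_right, hcoord]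
  set y := ⟪n, q - a⟫ with hy
  have hq : D * (κ - ⟪g, a⟫) = α * s + β * y := by rw [← hgp, hline, hrs]
  have hga := hgP a ha
  have hgb := hgP _ hb
  rw [inner_add_right, ← hα] at hgb
  have e1 : 0 ≤ D * (κ - ⟪g, a⟫) := mul_nonneg hD0.le (by linarith)
  have e2 : D * α ≤ D * (κ - ⟪g, a⟫) := mul_le_mul_of_nonneg_left (by linarith) hD0.le
  obtain ⟨hs1, hs2⟩ := hs
  have hβy : |α| * (D / 3) ≤ β * y := by
    rcases abs_cases α with ⟨h1, h2⟩ | ⟨h1, h2⟩ <;> rw [h1] <;> nlinarith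
  have hyy : α * (s' - s) + β * ⟪n, q' - q⟫ = 0 := by
    have := hcoord g (q' - q)
    rw [inner_sub_right g, hgp, hgp', hΔ] at this
    linarith
  have hβ0 : β ≠ 0 := by
    intro h0
    rw [h0, zero_mul, add_zero] at hyy
    have hα0 : α = 0 := (mul_eq_zero.1 hyy).resolve_right (sub_ne_zero.2 hne.symm)
    have := hcoord g g
    rw [← hα, ← hβ, hα0, h0] at this
    have : 0 < D * ⟪g, g⟫ := mul_pos hD0 (real_inner_self_pos.2 hg0)
    linarith
  have hy0 : 0 ≤ y := by
    have := hmax (a + (s / D) • r) (by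
      have : (1 - s / D) • a + (s / D) • (a + r) ∈ P := by
        apply hP ha hb
        · rw [sub_nonneg, div_le_one hD0]; linarith
        · exact div_nonneg (by linarith) hD0.le
        · ring
      convert this using 1
      module) (by rw [add_sub_cancel_left, inner_smul_right, ← hD]; field_simp)
    rwa [add_sub_cancel_left, inner_smul_right, hnr, mul_zero] at this
  have hβpos : 0 < β := by
    by_contra hneg
    have hβneg : β < 0 := lt_of_le_of_ne (not_lt.1 hneg) hβ0
    have h1 : β * y ≤ 0 := mul_nonpos_of_nonpos_of_nonneg hβneg.le hy0
    have h2 : 0 ≤ |α| * (D / 3) := by positivity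
    have hα0 : α = 0 := by
      rw [← abs_eq_zero]
      exact (mul_eq_zero.1 (le_antisymm (hβy.trans h1) h2)).resolve_right (by positivity)
    have hβy0 : β * y = 0 := by rw [hα0] at hβy; simp at hβy; linarith
    have hy00 : y = 0 := (mul_eq_zero.1 hβy0).resolve_left hβ0
    have hκ : κ - ⟪g, a⟫ = 0 := by
      rw [hα0, hβy0] at hq
      exact (mul_eq_zero.1 (by linarith : D * (κ - ⟪g, a⟫) = 0)).resolve_left hD0.ne'
    have hzpos : 0 < ⟪n, z - a⟫ := by
      have h3 := hline z
      have h4 := mul_nonneg hD0.le (sub_nonneg.2 (hgP z hz))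
      have h5 : β * ⟪n, z - a⟫ ≤ 0 := by rw [hα0] at h3; nlinarith
      have h6 : 0 ≤ ⟪n, z - a⟫ := by
        by_contra h7
        have := mul_pos_of_neg_of_neg hβneg (not_le.1 h7)
        linarith
      exact lt_of_le_of_ne h6 hzn.symm
    set x := ⟪r, z - a⟫ with hx
    have hcontra (t : ℝ) (w : Plane) (hw : w ∈ P) (hwn : ⟪n, w - a⟫ = 0) (ht0 : 0 < t)
        (ht1 : t ≤ 1) (hts : (1 - t) * ⟪r, w - a⟫ + t * x = s) : False := by
      have hmem : (1 - t) • w + t • z ∈ P := hP hw hz (by linarith) ht0.le (by ring)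
      have hsplit : (1 - t) • w + t • z - a = (1 - t) • (w - a) + t • (z - a) := by module
      have := hmax _ hmem (by
        rw [hsplit, inner_add_right, inner_smul_right, inner_smul_right, ← hx, hts])
      rw [hsplit, inner_add_right, inner_smul_right, inner_smul_right, hwn, hy00] at this
      have := mul_pos ht0 hzpos
      linarith
    rcases le_total s x with hsx | hsx
    · refine hcontra (s / x) a ha (by simp) (div_pos (by linarith) (by linarith))
        ((div_le_one (by linarith)).2 hsx) ?_
      have : x ≠ 0 := by linarith
      simp
      field_simp
    · have hDx : 0 < D - x := by linarith
      refine hcontra ((D - s) / (D - x)) (a + r) hb (by simpa using hnr)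
        (div_pos (by linarith) hDx) ((div_le_one hDx).2 (by linarith)) ?_
      rw [add_sub_cancel_left, ← hD]
      field_simp
      ring
  have hyW : y ≤ W := (le_abs_self y).trans (hW q hqP)
  refine ⟨c, d, q, q', g, hcd, hseg ▸ ⟨hqP, hgp⟩, hseg ▸ ⟨hqP', hgp'⟩, hrs ▸ hs1, hrs ▸ hs2,
    by rw [hΔ]; exact sub_ne_zero.2 hne.symm, ?_, ?_, hβpos, fun x hx => hgp ▸ hgP x hx,
    hgp'.trans hgp.symm⟩
  · rw [hΔ]
    have h1 : |α| * |s' - s| = β * |⟪n, q' - q⟫| := by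
      rw [← abs_mul, show α * (s' - s) = -(β * ⟪n, q' - q⟫) by linarith, abs_neg, abs_mul,
        abs_of_pos hβpos]
    have h2 : |α| * D ≤ 3 * W * β := by nlinarith
    refine le_of_mul_le_mul_left ?_ hβpos
    calc β * (|⟪n, q' - q⟫| * D) = |α| * D * |s' - s| := by linear_combination (-D) * h1
      _ ≤ 3 * W * β * |s' - s| := by gcongr
      _ = β * (3 * W * |s' - s|) := by ring
  · exact exists_eq_smul_of_inner_eq_zero hg0 (sub_ne_zero.2 hqq.symm)
      (sub_ne_zero.2 hcd.1.symm) (by rw [inner_sub_right, hgp, hgp', sub_self])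
      (by rw [inner_sub_right, hcκ, hdκ, sub_self])

/-- Two directions of bounded slope with respect to `r` make a small angle. -/
theorem lineAngle_le_of_slope_le {r n e e' : Plane} {W : ℝ} (hr : r ≠ 0)
    (hn0 : n 0 = -r 1) (hn1 : n 1 = r 0) (hW : 0 ≤ W) (he : e ≠ 0) (he' : e' ≠ 0)
    (h : |⟪n, e⟫| * ⟪r, r⟫ ≤ 3 * W * |⟪r, e⟫|)
    (h' : |⟪n, e'⟫| * ⟪r, r⟫ ≤ 3 * W * |⟪r, e'⟫|) :
    lineAngle e e' ≤ π / 2 * (6 * W / ⟪r, r⟫) := by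
  apply lineAngle_le_of_abs_cross_le he he'
  have hD : 0 < ⟪r, r⟫ := real_inner_self_pos.2 hr
  have hcross : ⟪r, r⟫ * (e 0 * e' 1 - e 1 * e' 0) = ⟪r, e⟫ * ⟪n, e'⟫ - ⟪n, e⟫ * ⟪r, e'⟫ := by
    simp only [plane_inner, hn0, hn1]
    ring
  have hX : |⟪r, e⟫| ≤ ‖r‖ * ‖e‖ := abs_real_inner_le_norm r e
  have hX' : |⟪r, e'⟫| ≤ ‖r‖ * ‖e'‖ := abs_real_inner_le_norm r e'
  have hXX : |⟪r, e⟫| * |⟪r, e'⟫| ≤ ⟪r, r⟫ * (‖e‖ * ‖e'‖) := by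
    calc _ ≤ ‖r‖ * ‖e‖ * (‖r‖ * ‖e'‖) := by gcongr
      _ = _ := by rw [real_inner_self_eq_norm_mul_norm]; ring
  have h1 : ⟪r, r⟫ * |e 0 * e' 1 - e 1 * e' 0| ≤ |⟪r, e⟫| * |⟪n, e'⟫| + |⟪n, e⟫| * |⟪r, e'⟫| := by
    rw [show ⟪r, r⟫ * |e 0 * e' 1 - e 1 * e' 0| = |⟪r, r⟫ * (e 0 * e' 1 - e 1 * e' 0)| by
      rw [abs_mul, abs_of_pos hD], hcross, ← abs_mul, ← abs_mul]
    exact abs_sub _ _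
  have h2 := mul_le_mul_of_nonneg_left h' (abs_nonneg ⟪r, e⟫)
  have h3 := mul_le_mul_of_nonneg_right h (abs_nonneg ⟪r, e'⟫)
  rw [div_mul_eq_mul_div, le_div_iff₀ hD]
  have h4 : ⟪r, r⟫ * (⟪r, r⟫ * |e 0 * e' 1 - e 1 * e' 0|) ≤
      ⟪r, r⟫ * (6 * W * (‖e‖ * ‖e'‖)) := by
    have := mul_le_mul_of_nonneg_left h1 hD.le
    have := mul_le_mul_of_nonneg_left hXX (by positivity : 0 ≤ 6 * W)
    linarith
  linarith [le_of_mul_le_mul_left h4 hD]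

/-- If the long direction `r` of a polygon of height `W` meets two opposite sides of the unit
square in its middle part, then the height is bounded below. -/
theorem inner_self_le_of_opposite {r n a p p' q h : Plane} {W : ℝ} (hr : r ≠ 0)
    (hnr : ⟪n, r⟫ = 0) (hnn : ⟪n, n⟫ = ⟪r, r⟫) (hh : ⟪h, h⟫ = 1)
    (hp : |⟪n, p - a⟫| ≤ W) (hq : |⟪n, q - a⟫| ≤ W)
    (hp1 : ⟪r, r⟫ / 3 ≤ ⟪r, p - a⟫) (hp2 : ⟪r, p - a⟫ ≤ 2 * ⟪r, r⟫ / 3)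
    (hq1 : ⟪r, r⟫ / 3 ≤ ⟪r, q - a⟫) (hq2 : ⟪r, q - a⟫ ≤ 2 * ⟪r, r⟫ / 3)
    (hpp : ⟪r, p' - p⟫ ≠ 0) (hslope : |⟪n, p' - p⟫| * ⟪r, r⟫ ≤ 3 * W * |⟪r, p' - p⟫|)
    (hhp : ⟪h, p' - p⟫ = 0) (hhq : |⟪h, p - q⟫| = 1) :
    ⟪r, r⟫ ≤ 9 * W ^ 2 := by
  have hD : 0 < ⟪r, r⟫ := real_inner_self_pos.2 hr
  have hcoord := inner_mul_inner_eq hr hnr hnn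
  have e1 := hcoord h h
  have e2 := hcoord h (p' - p)
  have e3 := hcoord h (p - q)
  rw [real_inner_comm h r, real_inner_comm h n, hh] at e1
  rw [hhp] at e2
  have hr3 : |⟪r, p - q⟫| ≤ ⟪r, r⟫ / 3 := by
    have : ⟪r, p - q⟫ = ⟪r, p - a⟫ - ⟪r, q - a⟫ := by rw [← inner_sub_right]; congr 1; abel
    rw [this, abs_le]
    constructor <;> linarith
  have hn3 : |⟪n, p - q⟫| ≤ 2 * W := by
    have : ⟪n, p - q⟫ = ⟪n, p - a⟫ - ⟪n, q - a⟫ := by rw [← inner_sub_right]; congr 1; abel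
    rw [this]
    linarith [abs_sub ⟪n, p - a⟫ ⟪n, q - a⟫]
  generalize ⟪r, r⟫ = D at *
  generalize ⟪h, r⟫ = x at *
  generalize ⟪h, n⟫ = y at *
  generalize ⟪h, p - q⟫ = δ at *
  generalize ⟪r, p' - p⟫ = u at *
  generalize ⟪n, p' - p⟫ = v at *
  generalize ⟪r, p - q⟫ = s at *
  generalize ⟪n, p - q⟫ = t at *
  have hu : 0 < |u| := abs_pos.2 hpp
  have hxy : |x| * |u| = |y| * |v| := by
    rw [← abs_mul, ← abs_mul, show x * u = -(y * v) by linarith, abs_neg]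
  have hx : |x| * D ≤ 3 * W * |y| := by
    refine le_of_mul_le_mul_right ?_ hu
    calc |x| * D * |u| = |y| * (|v| * D) := by linear_combination D * hxy
      _ ≤ |y| * (3 * W * |u|) := by gcongr
      _ = _ := by ring
  have h1 : D ≤ |x| * |s| + |y| * |t| := by
    calc D = |D * δ| := by rw [abs_mul, hhq, abs_of_pos hD, mul_one]
      _ ≤ |x * s| + |y * t| := by rw [e3]; exact abs_add_le _ _
      _ = _ := by rw [abs_mul, abs_mul]
  have h2 : |x| * |s| ≤ |x| * (D / 3) := by gcongr
  have h3 : |y| * |t| ≤ |y| * (2 * W) := by gcongr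
  have h4 : D ≤ 3 * W * |y| := by linarith
  have h5 : |y| ^ 2 ≤ D := by
    rw [sq_abs]
    nlinarith [sq_nonneg x]
  have h6 : D ^ 2 ≤ (3 * W * |y|) ^ 2 := by gcongr
  have h7 : (3 * W * |y|) ^ 2 ≤ 9 * W ^ 2 * D := by
    rw [show (3 * W * |y|) ^ 2 = 9 * W ^ 2 * |y| ^ 2 by ring]
    gcongr
  refine le_of_mul_le_mul_right ?_ hD
  linarith

theorem inner_self_le_of_mem_opposite_sides {r n a c d p p' c' d' q : Plane} {W : ℝ}
    (hr : r ≠ 0) (hnr : ⟪n, r⟫ = 0) (hnn : ⟪n, n⟫ = ⟪r, r⟫)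
    (hp : p ∈ segment ℝ c d) (hp' : p' ∈ segment ℝ c d) (hq : q ∈ segment ℝ c' d')
    (hopp : (segment ℝ c d ⊆ topSide ∧ segment ℝ c' d' ⊆ bottomSide) ∨
      (segment ℝ c d ⊆ bottomSide ∧ segment ℝ c' d' ⊆ topSide) ∨
      (segment ℝ c d ⊆ leftSide ∧ segment ℝ c' d' ⊆ rightSide) ∨
      (segment ℝ c d ⊆ rightSide ∧ segment ℝ c' d' ⊆ leftSide))
    (hpW : |⟪n, p - a⟫| ≤ W) (hqW : |⟪n, q - a⟫| ≤ W)
    (hp1 : ⟪r, r⟫ / 3 ≤ ⟪r, p - a⟫) (hp2 : ⟪r, p - a⟫ ≤ 2 * ⟪r, r⟫ / 3)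
    (hq1 : ⟪r, r⟫ / 3 ≤ ⟪r, q - a⟫) (hq2 : ⟪r, q - a⟫ ≤ 2 * ⟪r, r⟫ / 3)
    (hpp : ⟪r, p' - p⟫ ≠ 0) (hslope : |⟪n, p' - p⟫| * ⟪r, r⟫ ≤ 3 * W * |⟪r, p' - p⟫|) :
    ⟪r, r⟫ ≤ 9 * W ^ 2 := by
  have key (h : Plane) (hh : ⟪h, h⟫ = 1) (hhp : ⟪h, p' - p⟫ = 0) (hhq : |⟪h, p - q⟫| = 1) :=
    inner_self_le_of_opposite hr hnr hnn hh hpW hqW hp1 hp2 hq1 hq2 hpp hslope hhp hhq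
  have h01 : ⟪(!₂[0, 1] : Plane), !₂[0, 1]⟫ = 1 := by rw [plane_inner]; simp
  have h10 : ⟪(!₂[1, 0] : Plane), !₂[1, 0]⟫ = 1 := by rw [plane_inner]; simp
  rcases hopp with ⟨h, h'⟩ | ⟨h, h'⟩ | ⟨h, h'⟩ | ⟨h, h'⟩
  · refine key _ h01 ?_ ?_ <;> simp [plane_inner, (h hp).2, (h hp').2, (h' hq).2]
  · refine key _ h01 ?_ ?_ <;> simp [plane_inner, (h hp).2, (h hp').2, (h' hq).2]
  · refine key _ h10 ?_ ?_ <;> simp [plane_inner, (h hp).2, (h hp').2, (h' hq).2]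
  · refine key _ h10 ?_ ?_ <;> simp [plane_inner, (h hp).2, (h hp').2, (h' hq).2]

/-- The supporting lines above and below a polygon with nonempty interior are distinct. -/
theorem inner_eq_zero_of_opposite_support {P : Set Plane} {r n g g' e a z p p' : Plane}
    (hnr : ⟪n, r⟫ = 0) (hr : r ≠ 0) (he : e ≠ 0)
    (hg : 0 < ⟪g, n⟫) (hg' : ⟪g', n⟫ < 0) (hge : ⟪g, e⟫ = 0) (hge' : ⟪g', e⟫ = 0)
    (hgP : ∀ x ∈ P, ⟪g, x⟫ ≤ ⟪g, p⟫) (hgP' : ∀ x ∈ P, ⟪g', x⟫ ≤ ⟪g', p'⟫)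
    (hpp : ⟪g, p'⟫ = ⟪g, p⟫) (ha : a ∈ P) (hb : a + r ∈ P) (hz : z ∈ P) :
    ⟪n, z - a⟫ = 0 := by
  have hg0 : g ≠ 0 := by rintro rfl; simp at hg
  have hg0' : g' ≠ 0 := by rintro rfl; simp at hg'
  obtain ⟨t, ht, rfl⟩ := exists_eq_smul_of_inner_eq_zero he hg0 hg0'
    (by rwa [real_inner_comm]) (by rwa [real_inner_comm])
  have ht0 : t < 0 := by
    rw [real_inner_smul_left] at hg'
    by_contra! h
    have := mul_nonneg h hg.le
    linarith
  have hline : ∀ x ∈ P, ⟪g, x⟫ = ⟪g, p⟫ := by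
    intro x hx
    refine le_antisymm (hgP x hx) ?_
    have := hgP' x hx
    rw [real_inner_smul_left, real_inner_smul_left, hpp] at this
    nlinarith
  have hgr : ⟪g, r⟫ = 0 := by
    have := hline _ hb
    rw [inner_add_right, hline a ha] at this
    linarith
  have hgz : ⟪g, z - a⟫ = 0 := by rw [inner_sub_right, hline z hz, hline a ha, sub_self]
  by_cases hza : z - a = 0
  · rw [hza, inner_zero_right]
  obtain ⟨s, -, hs⟩ := exists_eq_smul_of_inner_eq_zero hg0 hr hza hgr hgz
  rw [hs, inner_smul_right, hnr, mul_zero]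

theorem inner_eq_of_mem_segment {g c d x : Plane} (h : ⟪g, d - c⟫ = 0)
    (hx : x ∈ segment ℝ c d) : ⟪g, x⟫ = ⟪g, c⟫ := by
  rw [segment_eq_image'] at hx
  obtain ⟨t, -, rfl⟩ := hx
  rw [inner_add_right, inner_smul_right, h, mul_zero, add_zero]

/-- The height `W` of an angularly partitioned polygon over a segment `r` inside it is bounded
below in terms of the length of `r`. -/
theorem AngularInvariant.inner_self_le {k : ℕ} {P : Set Plane} (hP : AngularInvariant k P)
    {a r n z : Plane} {W : ℝ} (ha : a ∈ P) (hb : a + r ∈ P) (hz : z ∈ P) (hr : r ≠ 0)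
    (hn0 : n 0 = -r 1) (hn1 : n 1 = r 0) (hzmax : ∀ x ∈ P, |⟪n, x - a⟫| ≤ W)
    (hzn : ⟪n, z - a⟫ ≠ 0) : ⟪r, r⟫ ≤ (6 * k + 18) * W := by
  have hnr : ⟪n, r⟫ = 0 := by rw [plane_inner, hn0, hn1]; ring
  have hnn : ⟪n, n⟫ = ⟪r, r⟫ := by rw [plane_inner, plane_inner, hn0, hn1]; ring
  have hD : 0 < ⟪r, r⟫ := real_inner_self_pos.2 hr
  have hW : 0 < W := (abs_pos.2 hzn).trans_le (hzmax z hz)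
  have hD2 : ⟪r, r⟫ ≤ 2 := by
    obtain ⟨⟨h1, h2⟩, h3, h4⟩ := hP.separated.1 ha
    obtain ⟨⟨h5, h6⟩, h7, h8⟩ := hP.separated.1 hb
    simp only [PiLp.add_apply] at h5 h6 h7 h8
    have h9 : r 0 ^ 2 ≤ 1 := by
      rw [sq_le_one_iff_abs_le_one, abs_le]; constructor <;> linarith
    have h10 : r 1 ^ 2 ≤ 1 := by
      rw [sq_le_one_iff_abs_le_one, abs_le]; constructor <;> linarith
    rw [plane_inner]
    linarith
  obtain ⟨S, hS, hsupp⟩ := hP.support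
  obtain ⟨c, d, p, p', g, hcd, hp, hp', hp1, hp2, hpp, hpn, ⟨t, ht, htd⟩, hgn, hgP, hgp⟩ :=
    exists_edge_over_middle hP.convex hP.isCompact hS hsupp ha hb hz hr hnr hnn hzmax hzn
  obtain ⟨c', d', q, q', g', hcd', hq, hq', hq1, hq2, hqq, hqn, ⟨t', ht', htd'⟩, hgn', hgP',
    hgp'⟩ := exists_edge_over_middle (n := -n) (W := W) hP.convex hP.isCompact hS hsupp ha hb hz hr
      (by rw [inner_neg_left, hnr, neg_zero]) (by rw [inner_neg_neg, hnn])
      (fun x hx => by rw [inner_neg_left, abs_neg]; exact hzmax x hx)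
      (by rwa [inner_neg_left, neg_ne_zero])
  rw [inner_neg_left, abs_neg] at hqn
  rw [inner_neg_right, neg_pos] at hgn'
  have hpP : p ∈ P := hP.isCompact.isClosed.frontier_subset (hcd.2.1 hp)
  have hqP : q ∈ P := hP.isCompact.isClosed.frontier_subset (hcd'.2.1 hq)
  have he : p' - p ≠ 0 := by intro h; rw [h, inner_zero_right] at hpp; exact hpp rfl
  have he' : q' - q ≠ 0 := by intro h; rw [h, inner_zero_right] at hqq; exact hqq rfl
  have hdc : ⟪g, d - c⟫ = 0 := by
    rw [htd, inner_smul_right, inner_sub_right, hgp, sub_self, mul_zero]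
  have hgc (hseg : segment ℝ c d = segment ℝ c' d') {x : Plane} (hx : x ∈ segment ℝ c' d') :
      ⟪g, x⟫ = ⟪g, c⟫ := inner_eq_of_mem_segment hdc (hseg ▸ hx)
  have hdistinct : segment ℝ c d ≠ segment ℝ c' d' := by
    intro hseg
    refine hzn (inner_eq_zero_of_opposite_support hnr hr he' hgn hgn' ?_ ?_ hgP hgP' ?_ ha hb hz)
    · rw [inner_sub_right, hgc hseg hq, hgc hseg hq', sub_self]
    · rw [inner_sub_right, hgp', sub_self]
    · rw [hgc hseg hq, inner_eq_of_mem_segment hdc hp]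
  rcases hP.separated.2 c d c' d' hcd hcd' hdistinct with hangle | hopp
  · rw [htd, htd', lineAngle_smul_left ht, lineAngle_smul_right ht'] at hangle
    have h1 := hangle.trans (lineAngle_le_of_slope_le hr hn0 hn1 hW.le he he' hpn hqn)
    have hk : (0 : ℝ) < 2 * k + 6 := by positivity
    rw [div_le_iff₀ hk] at h1
    have h2 : π * ⟪r, r⟫ ≤ π * ((6 * k + 18) * W) := by
      calc π * ⟪r, r⟫ ≤ π / 2 * (6 * W / ⟪r, r⟫) * (2 * k + 6) * ⟪r, r⟫ := by gcongr
        _ = π * ((6 * k + 18) * W) := by field_simp; ring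
    exact le_of_mul_le_mul_left h2 pi_pos
  · have h1 := inner_self_le_of_mem_opposite_sides hr hnr hnn hp hp' hq hopp (hzmax p hpP)
      (hzmax q hqP) hp1 hp2 hq1 hq2 hpp hpn
    have h2 : ⟪r, r⟫ ^ 2 ≤ (18 * W) ^ 2 := by nlinarith
    have h3 : ⟪r, r⟫ ≤ 18 * W := (sq_le_sq₀ hD.le (by positivity)).1 h2
    have h4 : 0 ≤ (k : ℝ) * W := by positivity
    linarith

theorem exists_diam_le_dist {α : Type*} [PseudoMetricSpace α] {s : Set α} (hs : IsCompact s)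
    (hne : s.Nonempty) : ∃ a ∈ s, ∃ b ∈ s, Metric.diam s ≤ dist a b := by
  obtain ⟨x, hx, hmax⟩ := (hs.prod hs).exists_isMaxOn (hne.prod hne)
    (f := fun x => dist x.1 x.2) (by fun_prop)
  exact ⟨x.1, hx.1, x.2, hx.2, Metric.diam_le_of_forall_dist_le dist_nonneg
    fun y hy z hz => hmax (Set.mk_mem_prod hy hz)⟩

theorem AngularInvariant.aspectRatio_le {k : ℕ} {P : Set Plane} (hP : AngularInvariant k P) :
    Metric.diam P ^ 2 / (volume P).toReal ≤ 72 * ((k : ℝ) + 1) := by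
  by_cases hvol : (volume P).toReal = 0
  · rw [hvol, div_zero]; positivity
  have hvol0 : volume P ≠ 0 := fun h => hvol (by rw [h, ENNReal.toReal_zero])
  have hne : P.Nonempty := by
    rw [Set.nonempty_iff_ne_empty]
    rintro rfl
    exact hvol0 measure_empty
  obtain ⟨a, ha, b, hb, hdiam⟩ := exists_diam_le_dist hP.isCompact hne
  have hvolpos : 0 < (volume P).toReal := lt_of_le_of_ne ENNReal.toReal_nonneg (Ne.symm hvol)
  rw [div_le_iff₀ hvolpos]
  by_cases hab : a = b
  · have : Metric.diam P = 0 := le_antisymm (by simpa [hab] using hdiam) Metric.diam_nonneg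
    rw [this, zero_pow two_ne_zero]
    positivity
  obtain ⟨r, rfl⟩ : ∃ r, b = a + r := ⟨b - a, by abel⟩
  have hr : r ≠ 0 := by rintro rfl; simp at hab
  obtain ⟨n, hn0, hn1⟩ : ∃ n : Plane, n 0 = -r 1 ∧ n 1 = r 0 := ⟨!₂[-r 1, r 0], by simp⟩
  have hnr : ⟪n, r⟫ = 0 := by rw [plane_inner, hn0, hn1]; ring
  have hnn : ⟪n, n⟫ = ⟪r, r⟫ := by rw [plane_inner, plane_inner, hn0, hn1]; ring
  have hD : 0 < ⟪r, r⟫ := real_inner_self_pos.2 hr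
  have hn : n ≠ 0 := real_inner_self_pos.1 (hnn ▸ hD)
  obtain ⟨z, hz, hzmax⟩ := hP.isCompact.exists_isMaxOn hne (f := fun x => |⟪n, x - a⟫|)
    (by fun_prop)
  replace hzmax : ∀ x ∈ P, |⟪n, x - a⟫| ≤ |⟪n, z - a⟫| := fun x hx => hzmax hx
  have hzn : ⟪n, z - a⟫ ≠ 0 := by
    obtain ⟨w, hw, hwn⟩ := exists_inner_ne_zero_of_volume_ne_zero hvol0 hn a
    exact abs_pos.1 ((abs_pos.2 hwn).trans_le (hzmax w hw))
  have hvolW : |⟪n, z - a⟫| / 4 ≤ (volume P).toReal := by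
    convert le_volume_of_triangle hP.convex hP.isCompact ha hb hz using 3
    simp [plane_inner, hn0, hn1]
    ring
  set W := |⟪n, z - a⟫| with hWdef
  have hW : 0 < W := abs_pos.2 hzn
  have hdiam2 : Metric.diam P ^ 2 ≤ ⟪r, r⟫ := by
    rw [real_inner_self_eq_norm_sq]
    rw [dist_self_add_right] at hdiam
    gcongr
  suffices hmain : ⟪r, r⟫ ≤ (6 * k + 18) * W by
    have hk : (0 : ℝ) ≤ k := k.cast_nonneg
    nlinarith
  exact hP.inner_self_le ha hb hz hr hn0 hn1 hzmax hzn

/-- Every polygon generated by the angular partitioning method at level `k` (starting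
from the unit square and always cutting in the direction maximizing the minimum angle
with the edges of the current polygon) is `(π/(2k+6))`-separated, and consequently has
aspect ratio `O(k)`. -/
theorem stmt5 :
    ∃ C : ℝ, 0 < C ∧
      ∀ P : ℕ → Set Plane,
        P 0 = unitSquare →
        (∀ k : ℕ, ∃ u : Plane, IsAngularBestDir (P k) u ∧ IsCutPiece (P k) (P (k+1)) u) →
        ∀ k : ℕ,
          SeparatedPolygon (π / (2 * (k : ℝ) + 6)) (P k) ∧
          (Metric.diam (P k)) ^ 2 / (volume (P k)).toReal ≤ C * ((k : ℝ) + 1) := by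
  refine ⟨72, by norm_num, fun P h0 hstep k => ?_⟩
  have hP : AngularInvariant k (P k) := by
    induction k with
    | zero => exact h0 ▸ angularInvariant_unitSquare
    | succ k ih =>
      obtain ⟨u, hu, hQ⟩ := hstep k
      exact ih.of_isCutPiece hu hQ
  exact ⟨hP.separated, hP.aspectRatio_le⟩
end

section
/- Let P ⊆ U (the unit square) be a φ-separated convex polygon for some φ ∈ (0, π/4). Then the aspect ratio of P is O(1/φ); concretely, ar(P) = diam(P)²/area(P) ≤ C/φ for an absolute constant C. -/
open MeasureTheory Real

/-- The planar cross product. -/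
def cross (v w : Plane) : ℝ := v 0 * w 1 - v 1 * w 0

/-- The planar dot product. -/
def dot (v x : Plane) : ℝ := v 0 * x 0 + v 1 * x 1

theorem exists_coeff (f : Plane →L[ℝ] ℝ) : ∃ α β : ℝ, ∀ x, f x = α * x 0 + β * x 1 := by
  refine ⟨f (EuclideanSpace.single 0 1), f (EuclideanSpace.single 1 1), fun x => ?_⟩
  have hx : x = x 0 • EuclideanSpace.single 0 (1 : ℝ) + x 1 • EuclideanSpace.single 1 (1 : ℝ) := by
    ext i; fin_cases i <;> simp
  conv_lhs => rw [hx]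
  simp only [map_add, map_smul, smul_eq_mul]
  ring

theorem norm_sq_eq (v : Plane) : ‖v‖ ^ 2 = v 0 ^ 2 + v 1 ^ 2 := by
  simp [EuclideanSpace.norm_sq_eq, Fin.sum_univ_two]

theorem sin_angle_mul_norms (v w : Plane) :
    Real.sin (InnerProductGeometry.angle v w) * (‖v‖ * ‖w‖) = |cross v w| := by
  rw [InnerProductGeometry.sin_angle_mul_norm_mul_norm, ← Real.sqrt_sq_eq_abs]
  congr 1
  simp only [PiLp.inner_apply, Fin.sum_univ_two, RCLike.inner_apply, conj_trivial, cross]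
  ring

theorem mul_norms_le_cross {φ : ℝ} (h0 : 0 ≤ φ) {v w : Plane}
    (h : φ ≤ lineAngle v w) : φ * (‖v‖ * ‖w‖) ≤ 2 * |cross v w| := by
  rw [← sin_angle_mul_norms, ← mul_assoc (2 : ℝ)]
  refine mul_le_mul_of_nonneg_right ?_ (mul_nonneg (norm_nonneg v) (norm_nonneg w))
  obtain ⟨h1, h2⟩ := le_min_iff.1 h
  set θ := InnerProductGeometry.angle v w
  have hπ := Real.pi_le_four
  have hp := Real.pi_pos
  rcases le_total θ (π / 2) with h3 | h3
  · have := Real.mul_le_sin (h0.trans h1) h3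
    rw [div_mul_eq_mul_div, div_le_iff₀ hp] at this
    have h4 := Real.sin_nonneg_of_nonneg_of_le_pi (h0.trans h1) (by linarith)
    nlinarith
  · have := Real.mul_le_sin (h0.trans h2) (by linarith)
    rw [div_mul_eq_mul_div, div_le_iff₀ hp, Real.sin_pi_sub] at this
    have h4 := Real.sin_nonneg_of_nonneg_of_le_pi (x := θ) (by linarith) (by linarith)
    nlinarith

theorem Convex.abs_cross_le_volume {P : Set Plane} (hP : Convex ℝ P) (hc : IsCompact P)
    {p q u w : Plane} (hp : p ∈ P) (hq : q ∈ P) (hu : u ∈ P) (hw : w ∈ P) :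
    |cross (q - p) (u - w)| / 4 ≤ (volume P).toReal := by
  set b := EuclideanSpace.basisFun (Fin 2) ℝ
  let V : Fin 2 → Plane := ![(1 / 2 : ℝ) • (q - p), (1 / 2 : ℝ) • (u - w)]
  have hvol : volume (parallelepiped V) = ENNReal.ofReal (|cross (q - p) (u - w)| / 4) := by
    rw [← b.addHaar_eq_volume, Measure.addHaar_parallelepiped]
    congr 1
    rw [Module.Basis.det_apply, Matrix.det_fin_two]
    simp only [Module.Basis.toMatrix_apply, V, b, cross]
    simp
    rw [← Nat.abs_ofNat (R := ℝ) 4, ← abs_div]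
    congr 1
    ring
  have hsub : (fun x => ((1 / 2 : ℝ) • (p + w)) + x) '' parallelepiped V ⊆ P := by
    rintro _ ⟨x, hx, rfl⟩
    obtain ⟨t, ht, rfl⟩ := (mem_parallelepiped_iff V x).1 hx
    have h0 := And.intro (ht.1 0) (ht.2 0)
    have h1 := And.intro (ht.1 1) (ht.2 1)
    simp only [Pi.zero_apply, Pi.one_apply] at h0 h1
    have e1 : (1 - t 0) • p + t 0 • q ∈ P := hP hp hq (by linarith) h0.1 (by ring)
    have e2 : (1 - t 1) • w + t 1 • u ∈ P := hP hw hu (by linarith) h1.1 (by ring)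
    have e3 := hP e1 e2 (a := 1 / 2) (b := 1 / 2) (by norm_num) (by norm_num) (by norm_num)
    convert e3 using 1
    simp only [Fin.sum_univ_two, V, Matrix.cons_val_zero, Matrix.cons_val_one]
    module
  have hle := measure_mono (μ := volume) hsub
  rw [Set.image_add_left, measure_preimage_add, hvol] at hle
  exact (ENNReal.ofReal_le_iff_le_toReal hc.measure_lt_top.ne).1 hle

theorem eq_zero_of_functional {α β : ℝ} (h : α ≠ 0 ∨ β ≠ 0) {w z : Plane} (hw : w ≠ 0)
    (hfw : α * w 0 + β * w 1 = 0) (hfz : α * z 0 + β * z 1 = 0)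
    (hin : w 0 * z 0 + w 1 * z 1 = 0) : z = 0 := by
  have hdet : w 0 * z 1 - w 1 * z 0 = 0 := by
    rcases h with h | h
    · apply mul_left_cancel₀ h
      linear_combination z 1 * hfw - w 1 * hfz
    · apply mul_left_cancel₀ h
      linear_combination w 0 * hfz - z 0 * hfw
  have hprod : ‖w‖ ^ 2 * ‖z‖ ^ 2 = 0 := by
    rw [norm_sq_eq, norm_sq_eq]
    linear_combination (w 0 * z 0 + w 1 * z 1) * hin + (w 0 * z 1 - w 1 * z 0) * hdet
  simpa [hw] using hprod

theorem exists_edge_through {P : Set Plane} (hP : Convex ℝ P) (hc : IsCompact P)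
    (hne : (interior P).Nonempty) {F : Set Plane} (hF : P = convexHull ℝ F)
    {u : Plane} (huP : u ∈ P) (hui : u ∉ interior P) (huF : u ∉ F) :
    ∃ (a b : Plane) (α β : ℝ), IsEdgeOf P a b ∧ u ∈ segment ℝ a b ∧
      (∀ x ∈ P, α * x 0 + β * x 1 ≤ α * u 0 + β * u 1) ∧
      (∀ x ∈ interior P, α * x 0 + β * x 1 < α * u 0 + β * u 1) ∧
      ∀ x ∈ segment ℝ a b, α * x 0 + β * x 1 = α * u 0 + β * u 1 := by
  obtain ⟨f, hf⟩ := geometric_hahn_banach_open_point hP.interior isOpen_interior hui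
  obtain ⟨α, β, hfe⟩ := exists_coeff f
  have hle : ∀ x ∈ P, f x ≤ f u := by
    intro x hx
    have hx' : x ∈ closure (interior P) := by
      rw [hP.closure_interior_eq_closure_of_nonempty_interior hne]
      exact subset_closure hx
    exact closure_minimal (fun y hy => (hf y hy).le)
      (isClosed_le f.continuous continuous_const) hx'
  have hαβ : α ≠ 0 ∨ β ≠ 0 := by
    by_contra! h
    obtain ⟨y, hy⟩ := hne
    have := hf y hy
    simp [hfe, h.1, h.2] at this
  set G := P ∩ {x | f x = f u}
  have hGc : IsCompact G := hc.inter_right (isClosed_eq f.continuous continuous_const)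
  have hGconv : Convex ℝ G := by
    refine hP.inter ?_
    exact convex_hyperplane (f := f) f.toLinearMap.isLinear (f u)
  have hGfr : G ⊆ frontier P := fun x hx =>
    ⟨subset_closure hx.1, fun hxi => (hf x hxi).ne hx.2⟩
  have huG : u ∈ G := ⟨huP, rfl⟩
  obtain ⟨v, hvG, hvu⟩ : ∃ v ∈ G, v ≠ u := by
    by_contra! h
    apply huF
    apply extremePoints_convexHull_subset (𝕜 := ℝ)
    rw [← hF]
    refine mem_extremePoints.2 ⟨huP, fun x hx y hy hxy => ?_⟩
    obtain ⟨c, d, hc0, hd0, hcd, hu⟩ := hxy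
    have hfu : c * f x + d * f y = f u := by rw [← hu]; simp
    have hx1 := hle x hx
    have hy1 := hle y hy
    have hd : d = 1 - c := by linarith
    subst hd
    exact ⟨h x ⟨hx, by show f _ = f u; nlinarith⟩,
      h y ⟨hy, by show f _ = f u; nlinarith⟩⟩
  let g : Plane → ℝ := fun x => (v - u) 0 * x 0 + (v - u) 1 * x 1
  have hg : Continuous g := by fun_prop
  obtain ⟨a, haG, ha⟩ := hGc.exists_isMinOn ⟨u, huG⟩ hg.continuousOn
  obtain ⟨b, hbG, hb⟩ := hGc.exists_isMaxOn ⟨u, huG⟩ hg.continuousOn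
  have hguv : g u < g v := by
    have : 0 < ‖v - u‖ ^ 2 := by
      have := sub_ne_zero.2 hvu
      positivity
    rw [norm_sq_eq] at this
    simp only [g, PiLp.sub_apply] at this ⊢
    nlinarith
  have hgab : g a < g b := lt_of_le_of_lt (ha huG) (hguv.trans_le (hb hvG))
  have hab : a ≠ b := by rintro rfl; exact lt_irrefl _ hgab
  have hseg : G = segment ℝ a b := by
    apply Set.Subset.antisymm _ (hGconv.segment_subset haG hbG)
    intro x hx
    have h1 : g a ≤ g x := ha hx
    have h2 : g x ≤ g b := hb hx
    have hpos : 0 < g b - g a := by linarith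
    set l := (g x - g a) / (g b - g a)
    have hlm : l * (g b - g a) = g x - g a := div_mul_cancel₀ _ hpos.ne'
    refine ⟨1 - l, l, sub_nonneg.2 ((div_le_one hpos).2 (by linarith)),
      div_nonneg (by linarith) hpos.le, by ring, ?_⟩
    have e1 : f a = f u := haG.2
    have e2 : f b = f u := hbG.2
    have e3 : f x = f u := hx.2
    have e4 : f v = f u := hvG.2
    rw [hfe, hfe u] at e1 e2 e3 e4
    rw [← sub_eq_zero]
    apply eq_zero_of_functional hαβ (sub_ne_zero.2 hvu)
    · simp only [PiLp.sub_apply]; linear_combination e4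
    · simp only [PiLp.sub_apply, PiLp.add_apply, PiLp.smul_apply, smul_eq_mul]
      linear_combination (1 - l) * e1 + l * e2 - e3
    · simp only [g, PiLp.sub_apply, PiLp.add_apply, PiLp.smul_apply, smul_eq_mul] at hlm ⊢
      linear_combination hlm
  refine ⟨a, b, α, β, ⟨hab, hseg ▸ hGfr, fun c d hsub hfr => ?_⟩, hseg ▸ huG, ?_, ?_, ?_⟩
  · have hfrP : frontier P ⊆ P := hc.isClosed.frontier_subset
    have hcP := hfrP (hfr (left_mem_segment ℝ c d))
    have hdP := hfrP (hfr (right_mem_segment ℝ c d))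
    have key : ∀ c d : Plane, c ∈ P → d ∈ P → segment ℝ a b ⊆ segment ℝ c d → f c = f u := by
      intro c d hcP hdP hsub
      by_contra hne
      have hlt := lt_of_le_of_ne (hle c hcP) hne
      have hd1 := hle d hdP
      have key : ∀ x ∈ G, x = d := by
        intro x hx
        obtain ⟨r, s, hr, hs, hrs, rfl⟩ := hsub (hseg ▸ hx)
        have h1 : r * f c + s * f d = f u := by simpa using hx.2
        have hs' : s = 1 - r := by linarith
        subst hs'
        have : r = 0 := by nlinarith
        simp [this]
      exact hab ((key a haG).trans (key b hbG).symm)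
    refine Set.Subset.antisymm ?_ hsub
    rw [← hseg]
    refine hGconv.segment_subset ⟨hcP, key c d hcP hdP hsub⟩ ⟨hdP, key d c hdP hcP ?_⟩
    rwa [segment_symm ℝ d c]
  · intro x hx; simpa only [hfe] using hle x hx
  · intro x hx; simpa only [hfe] using hf x hx
  · intro x hx
    rw [← hseg] at hx
    have hx2 : f x = f u := hx.2
    simpa only [hfe] using hx2

theorem sub_mul_norm_sq (α β : ℝ) (v x y : Plane) :
    (α * x 0 + β * x 1 - (α * y 0 + β * y 1)) * ‖v‖ ^ 2 =
      (α * v 0 + β * v 1) * (dot v x - dot v y) + (β * v 0 - α * v 1) * (cross v x - cross v y) := by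
  rw [norm_sq_eq, dot, dot, cross, cross]
  ring

theorem abs_dot_le (v d : Plane) : |dot v d| ≤ ‖v‖ * ‖d‖ := by
  refine abs_le_of_sq_le_sq ?_ (by positivity)
  rw [mul_pow, norm_sq_eq, norm_sq_eq, dot]
  nlinarith [sq_nonneg (v 0 * d 1 - v 1 * d 0)]

theorem norm_sq_mul_abs_cross_le (v d e : Plane) :
    ‖v‖ ^ 2 * |cross d e| ≤ |dot v d| * |cross v e| + |cross v d| * |dot v e| := by
  have h : ‖v‖ ^ 2 * cross d e = dot v d * cross v e - cross v d * dot v e := by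
    rw [norm_sq_eq, cross, cross, cross, dot, dot]
    ring
  rw [← abs_mul, ← abs_mul, ← abs_of_nonneg (sq_nonneg ‖v‖), ← abs_mul, h]
  exact abs_sub _ _

theorem slope_le_of_support {α β : ℝ} {v p u d : Plane} (hv : v ≠ 0)
    (hp : α * p 0 + β * p 1 ≤ α * u 0 + β * u 1)
    (hq : α * (p + v) 0 + β * (p + v) 1 ≤ α * u 0 + β * u 1)
    (hB : β * v 0 - α * v 1 ≠ 0)
    (h1 : ‖v‖ ^ 2 / 3 ≤ dot v u - dot v p) (h2 : dot v u - dot v p ≤ 2 * ‖v‖ ^ 2 / 3)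
    (hd : α * d 0 + β * d 1 = 0) :
    |cross v d| * ‖v‖ ^ 2 ≤ 3 * |cross v u - cross v p| * |dot v d| := by
  have hL : 0 < ‖v‖ ^ 2 := by positivity
  have eu := sub_mul_norm_sq α β v u p
  have ed := sub_mul_norm_sq α β v d 0
  have e0 : dot v 0 = 0 := by simp [dot]
  have e1 : cross v 0 = 0 := by simp [cross]
  simp only [PiLp.zero_apply, hd, e0, e1] at ed
  simp only [PiLp.add_apply] at hq
  set A := α * v 0 + β * v 1 with hA
  set B := β * v 0 - α * v 1
  set s := dot v u - dot v p
  set t := cross v u - cross v p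
  set L := ‖v‖ ^ 2
  have k1 : 0 ≤ A * s + B * t := by rw [← eu]; exact mul_nonneg (by linarith) hL.le
  have k2 : A * L ≤ A * s + B * t := by
    rw [← eu]; exact mul_le_mul_of_nonneg_right (by rw [hA]; linarith) hL.le
  have k3 : |A| * L ≤ 3 * (|B| * |t|) := by
    have : |A| * L ≤ 3 * (B * t) := by
      rcases abs_cases A with ⟨h, h'⟩ | ⟨h, h'⟩ <;> rw [h] <;> nlinarith
    have := le_abs_self (B * t)
    rw [abs_mul] at this
    linarith
  have k4 : |B| * |cross v d| = |A| * |dot v d| := by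
    rw [← abs_mul, ← abs_mul, ← abs_neg]
    congr 1
    linarith
  have hB' : 0 < |B| := abs_pos.2 hB
  refine le_of_mul_le_mul_left ?_ hB'
  calc |B| * (|cross v d| * L) = (|A| * L) * |dot v d| := by linear_combination L * k4
    _ ≤ (3 * (|B| * |t|)) * |dot v d| := by gcongr
    _ = _ := by ring

theorem exists_add_smul_mem_of_mem_interior {P : Set Plane} {u : Plane} (hu : u ∈ interior P)
    (w : Plane) : ∃ δ : ℝ, 0 < δ ∧ u + δ • w ∈ P := by
  have hc : Filter.Tendsto (fun δ : ℝ => u + δ • w) (nhds 0) (nhds u) := by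
    have : Continuous (fun δ : ℝ => u + δ • w) := by fun_prop
    simpa using this.tendsto 0
  have h := (hc.eventually (mem_interior_iff_mem_nhds.1 hu)).filter_mono
    (nhdsWithin_le_nhds (s := Set.Ioi 0))
  obtain ⟨δ, h1, h2⟩ := (h.and self_mem_nhdsWithin).exists
  exact ⟨δ, h2, h1⟩

/-- The extreme point of `P` in the direction `σ` on the line `dot v x = m` perpendicular to the
chord from `p` to `p + v` lies on an edge with small slope relative to `v`. -/
theorem exists_flat_edge {P : Set Plane} (hP : Convex ℝ P) (hc : IsCompact P)
    {F : Set Plane} (hF : P = convexHull ℝ F) {v p y : Plane} (hv : v ≠ 0) (hp : p ∈ P)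
    (hq : p + v ∈ P) {m : ℝ} (hm : ∀ x ∈ F, dot v x ≠ m)
    (h1 : ‖v‖ ^ 2 / 3 ≤ m - dot v p) (h2 : m - dot v p ≤ 2 * ‖v‖ ^ 2 / 3)
    (hy : y ∈ interior P) (hym : dot v y = m) {σ : ℝ} (hσ : σ ≠ 0) :
    ∃ u a b : Plane, u ∈ P ∧ dot v u = m ∧ IsEdgeOf P a b ∧ u ∈ segment ℝ a b ∧
      σ * cross v y < σ * cross v u ∧ σ * cross v p ≤ σ * cross v u ∧
      (∀ x ∈ segment ℝ a b, dot v x = m → cross v x = cross v u) ∧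
      |cross v (b - a)| * ‖v‖ ^ 2 ≤ 3 * |cross v u - cross v p| * |dot v (b - a)| := by
  have hL : 0 < ‖v‖ ^ 2 := by positivity
  have hdc : Continuous (dot v) := by unfold dot; fun_prop
  have hcc : Continuous (fun x => σ * cross v x) := by unfold cross; fun_prop
  have hK : IsCompact (P ∩ {x | dot v x = m}) :=
    hc.inter_right (isClosed_eq hdc continuous_const)
  obtain ⟨u, ⟨huP, hum : dot v u = m⟩, hmax⟩ :=
    hK.exists_isMaxOn ⟨y, interior_subset hy, hym⟩ hcc.continuousOn
  have hui : u ∉ interior P := by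
    intro hui
    obtain ⟨δ, hδ, hmem⟩ := exists_add_smul_mem_of_mem_interior hui (σ • !₂[-v 1, v 0])
    have hd : dot v (u + δ • (σ • !₂[-v 1, v 0])) = m := by
      rw [← hum]; simp [dot]; ring
    have hcr : cross v (u + δ • (σ • !₂[-v 1, v 0])) = cross v u + δ * σ * ‖v‖ ^ 2 := by
      rw [norm_sq_eq]; simp [cross]; ring
    have := hmax ⟨hmem, hd⟩
    simp only [Set.mem_ofPred_eq, hcr] at this
    have : 0 < δ * (σ * σ) * ‖v‖ ^ 2 := by
      have := mul_self_pos.2 hσ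
      positivity
    nlinarith
  obtain ⟨a, b, α, β, hedge, hus, hle, hlt, hab⟩ :=
    exists_edge_through hP hc ⟨y, hy⟩ hF huP hui (fun h => hm u h hum)
  have hBt : 0 < (β * v 0 - α * v 1) * (cross v u - cross v y) := by
    have e := sub_mul_norm_sq α β v u y
    rw [hum, hym, sub_self, mul_zero, zero_add] at e
    rw [← e]
    exact mul_pos (sub_pos.2 (hlt y hy)) hL
  have hB : β * v 0 - α * v 1 ≠ 0 := by
    intro h; simp [h] at hBt
  have hproj : p + ((m - dot v p) / ‖v‖ ^ 2) • v ∈ P := by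
    have h0 : 0 ≤ (m - dot v p) / ‖v‖ ^ 2 := div_nonneg (by linarith) hL.le
    have h3 : (m - dot v p) / ‖v‖ ^ 2 ≤ 1 := (div_le_one hL).2 (by linarith)
    convert hP hp hq (sub_nonneg.2 h3) h0 (by ring) using 1
    module
  refine ⟨u, a, b, huP, hum, hedge, hus, ?_, ?_, ?_, ?_⟩
  · refine lt_of_le_of_ne (hmax ⟨interior_subset hy, hym⟩) fun h => ?_
    rw [mul_left_cancel₀ hσ h] at hBt
    simp at hBt
  · have hpd : dot v (p + ((m - dot v p) / ‖v‖ ^ 2) • v) = m := by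
      have : dot v (p + ((m - dot v p) / ‖v‖ ^ 2) • v) =
          dot v p + (m - dot v p) / ‖v‖ ^ 2 * ‖v‖ ^ 2 := by
        conv_rhs => rw [norm_sq_eq v]
        simp only [dot, PiLp.add_apply, PiLp.smul_apply, smul_eq_mul]
        rw [norm_sq_eq v]
        ring
      rw [this, div_mul_cancel₀ _ hL.ne']
      ring
    have hpc : cross v (p + ((m - dot v p) / ‖v‖ ^ 2) • v) = cross v p := by
      simp only [cross, PiLp.add_apply, PiLp.smul_apply, smul_eq_mul]
      ring
    have := hmax ⟨hproj, hpd⟩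
    simpa only [Set.mem_ofPred_eq, hpc] using this
  · intro x hx hxm
    have e := sub_mul_norm_sq α β v x u
    rw [hum, hxm, hab x hx] at e
    have : (β * v 0 - α * v 1) * (cross v x - cross v u) = 0 := by linarith
    exact sub_eq_zero.1 ((mul_eq_zero.1 this).resolve_left hB)
  · refine slope_le_of_support hv (hle p hp) (hle _ hq) hB (by rwa [hum]) (by rwa [hum]) ?_
    have ha := hab a (left_mem_segment ℝ a b)
    have hb := hab b (right_mem_segment ℝ a b)
    simp only [PiLp.sub_apply]
    linarith

theorem exists_mem_interior_dot_eq {P : Set Plane} (hP : Convex ℝ P)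
    (hne : (interior P).Nonempty) {v p q : Plane} (hp : p ∈ P) (hq : q ∈ P) {m : ℝ}
    (h1 : dot v p < m) (h2 : m < dot v q) : ∃ y ∈ interior P, dot v y = m := by
  have hdc : Continuous (dot v) := by unfold dot; fun_prop
  have hcl : P ⊆ closure (interior P) := by
    rw [hP.closure_interior_eq_closure_of_nonempty_interior hne]
    exact subset_closure
  obtain ⟨a, ha, hai⟩ := mem_closure_iff.1 (hcl hp) _ (isOpen_lt hdc continuous_const) h1
  obtain ⟨b, hb, hbi⟩ := mem_closure_iff.1 (hcl hq) _ (isOpen_lt continuous_const hdc) h2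
  exact hP.interior.isPreconnected.intermediate_value hai hbi hdc.continuousOn
    ⟨le_of_lt ha, le_of_lt hb⟩

theorem exists_dist_eq_diam_of_isCompact {P : Set Plane} (hc : IsCompact P) (hne : P.Nonempty) :
    ∃ p ∈ P, ∃ q ∈ P, dist p q = Metric.diam P := by
  obtain ⟨⟨p, q⟩, ⟨hp, hq⟩, hmax⟩ := (hc.prod hc).exists_isMaxOn (hne.prod hne)
    (f := fun z : Plane × Plane => dist z.1 z.2) (by fun_prop)
  refine ⟨p, hp, q, hq, le_antisymm (Metric.dist_le_diam_of_mem hc.isBounded hp hq) ?_⟩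
  exact Metric.diam_le_of_forall_dist_le dist_nonneg fun x hx y hy =>
    isMaxOn_iff.1 hmax (x, y) ⟨hx, hy⟩

theorem one_le_norm_sub_of_opposite_sides {S T : Set Plane} {u w : Plane} (hu : u ∈ S)
    (hw : w ∈ T)
    (h : (S ⊆ topSide ∧ T ⊆ bottomSide) ∨ (S ⊆ bottomSide ∧ T ⊆ topSide) ∨
      (S ⊆ leftSide ∧ T ⊆ rightSide) ∨ (S ⊆ rightSide ∧ T ⊆ leftSide)) : 1 ≤ ‖u - w‖ := by
  have key : ∀ i : Fin 2, |u i - w i| = 1 → 1 ≤ ‖u - w‖ := fun i hi => by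
    rw [← hi]; exact PiLp.norm_apply_le (u - w) i
  rcases h with ⟨h, h'⟩ | ⟨h, h'⟩ | ⟨h, h'⟩ | ⟨h, h'⟩
  · exact key 1 (by rw [(h hu).2, (h' hw).2]; norm_num)
  · exact key 1 (by rw [(h hu).2, (h' hw).2]; norm_num)
  · exact key 0 (by rw [(h hu).2, (h' hw).2]; norm_num)
  · exact key 0 (by rw [(h hu).2, (h' hw).2]; norm_num)

theorem norm_sub_le_two_of_mem_unitSquare {p q : Plane} (hp : p ∈ unitSquare)
    (hq : q ∈ unitSquare) : ‖q - p‖ ≤ 2 := by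
  obtain ⟨⟨a1, a2⟩, a3, a4⟩ := hp
  obtain ⟨⟨b1, b2⟩, b3, b4⟩ := hq
  refine abs_le_of_sq_le_sq' ?_ (by norm_num) |>.2
  rw [norm_sq_eq, PiLp.sub_apply, PiLp.sub_apply]
  nlinarith

theorem mul_diam_sq_le_volume {φ : ℝ} (h0 : 0 < φ) (h1 : φ < π / 4) {P : Set Plane}
    (hP : Convex ℝ P) (hc : IsCompact P) (hne : (interior P).Nonempty) {F : Finset Plane}
    (hF : P = convexHull ℝ (F : Set Plane)) (hsep : SeparatedPolygon φ P) :
    φ * Metric.diam P ^ 2 ≤ 24 * (volume P).toReal := by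
  obtain ⟨p, hp, q, hq, hpq⟩ := exists_dist_eq_diam_of_isCompact hc (hne.mono interior_subset)
  rw [← hpq, dist_comm, dist_eq_norm]
  rcases eq_or_ne q p with rfl | hqp
  · simp
  obtain ⟨v, rfl⟩ : ∃ v, q = p + v := ⟨q - p, by simp⟩
  have hv : v ≠ 0 := by simpa using hqp
  have hL : 0 < ‖v‖ ^ 2 := by positivity
  have hn2 := norm_sub_le_two_of_mem_unitSquare (hsep.1 hp) (hsep.1 hq)
  rw [add_sub_cancel_left] at hn2 ⊢
  have hdq : dot v (p + v) = dot v p + ‖v‖ ^ 2 := by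
    rw [norm_sq_eq, dot, dot, PiLp.add_apply, PiLp.add_apply]
    ring
  obtain ⟨m, ⟨hm1, hm2⟩, hmF⟩ := (Set.Ioo_infinite (show dot v p + ‖v‖ ^ 2 / 3 <
    dot v p + 2 * ‖v‖ ^ 2 / 3 by linarith)).exists_notMem_finset (F.image (dot v))
  have hmF' : ∀ x ∈ (F : Set Plane), dot v x ≠ m := fun x hx h =>
    hmF (Finset.mem_image.2 ⟨x, hx, h⟩)
  obtain ⟨y, hy, hym⟩ := exists_mem_interior_dot_eq hP hne hp hq (v := v) (m := m)
    (by linarith) (by linarith)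
  obtain ⟨u, a, b, hu, hum, hedge, hus, huy, hup, heq, hsl⟩ :=
    exists_flat_edge hP hc hF hv hp hq hmF' (by linarith) (by linarith) hy hym one_ne_zero
  obtain ⟨w, a', b', hw, hwm, hedge', hws, hwy, hwp, -, hsl'⟩ :=
    exists_flat_edge hP hc hF hv hp hq hmF' (by linarith) (by linarith) hy hym
      (σ := -1) (by norm_num)
  have hcr : cross v (u - w) = cross v u - cross v w := by
    simp only [cross, PiLp.sub_apply]; ring
  have hvol := hP.abs_cross_le_volume hc hp hq hu hw
  rw [add_sub_cancel_left, hcr, abs_of_pos (by linarith)] at hvol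
  rcases hsep.2 a b a' b' hedge hedge' fun h => by
    have := heq w (h ▸ hws) hwm
    linarith with hang | hopp
  · rw [abs_of_nonneg (by linarith : 0 ≤ cross v u - cross v p)] at hsl
    rw [abs_of_nonpos (by linarith : cross v w - cross v p ≤ 0)] at hsl'
    have hcross := mul_norms_le_cross h0.le hang
    have hd : 0 < ‖b - a‖ := norm_pos_iff.2 (sub_ne_zero.2 hedge.1.symm)
    have hd' : 0 < ‖b' - a'‖ := norm_pos_iff.2 (sub_ne_zero.2 hedge'.1.symm)
    have hlag := norm_sq_mul_abs_cross_le v (b - a) (b' - a')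
    have hdot : |dot v (b - a)| * |dot v (b' - a')| ≤ ‖v‖ ^ 2 * (‖b - a‖ * ‖b' - a'‖) := by
      calc _ ≤ (‖v‖ * ‖b - a‖) * (‖v‖ * ‖b' - a'‖) := by gcongr <;> exact abs_dot_le _ _
        _ = _ := by ring
    set N := ‖b - a‖ * ‖b' - a'‖
    have hN : 0 < N := mul_pos hd hd'
    set T := cross v u - cross v w
    have hT : 0 ≤ T := by linarith
    have key : ‖v‖ ^ 2 * (‖v‖ ^ 2 * |cross (b - a) (b' - a')|) ≤ ‖v‖ ^ 2 * (3 * T * N) := by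
      calc _ ≤ ‖v‖ ^ 2 * (|dot v (b - a)| * |cross v (b' - a')| +
            |cross v (b - a)| * |dot v (b' - a')|) := by gcongr
        _ = |dot v (b - a)| * (|cross v (b' - a')| * ‖v‖ ^ 2) +
            (|cross v (b - a)| * ‖v‖ ^ 2) * |dot v (b' - a')| := by ring
        _ ≤ |dot v (b - a)| * (3 * -(cross v w - cross v p) * |dot v (b' - a')|) +
            (3 * (cross v u - cross v p) * |dot v (b - a)|) * |dot v (b' - a')| := by gcongr
        _ = 3 * T * (|dot v (b - a)| * |dot v (b' - a')|) := by simp only [T]; ring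
        _ ≤ 3 * T * (‖v‖ ^ 2 * N) := by gcongr
        _ = _ := by ring
    have key' := le_of_mul_le_mul_left key hL
    have : φ * ‖v‖ ^ 2 ≤ 6 * T := by
      refine le_of_mul_le_mul_right ?_ hN
      nlinarith
    linarith
  · have hone := one_le_norm_sub_of_opposite_sides hus hws hopp
    have hsq : ‖v‖ ^ 2 * ‖u - w‖ ^ 2 = (cross v u - cross v w) ^ 2 := by
      have hdw : dot v u - dot v w = 0 := by rw [hum, hwm, sub_self]
      rw [norm_sq_eq, norm_sq_eq, PiLp.sub_apply, PiLp.sub_apply]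
      simp only [dot, cross] at hdw ⊢
      linear_combination (v 0 * u 0 + v 1 * u 1 - (v 0 * w 0 + v 1 * w 1)) * hdw
    have hT : ‖v‖ ≤ cross v u - cross v w := by
      refine abs_le_of_sq_le_sq' ?_ (by linarith) |>.2
      rw [← hsq]
      exact le_mul_of_one_le_right hL.le (one_le_pow₀ hone)
    have hφ : φ < 1 := by linarith [Real.pi_le_four]
    nlinarith [norm_nonneg v]

/-- A `φ`-separated convex polygon contained in the unit square, with `φ ∈ (0, π/4)`,
has aspect ratio `diam² / area ≤ C/φ` for an absolute constant `C`. -/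
theorem stmt6 :
    ∃ C : ℝ, 0 < C ∧
      ∀ φ : ℝ, φ ∈ Set.Ioo 0 (π/4) →
      ∀ P : Set Plane, Convex ℝ P → IsCompact P → (interior P).Nonempty →
        (∃ F : Finset Plane, P = convexHull ℝ (F : Set Plane)) →
        SeparatedPolygon φ P →
        (Metric.diam P) ^ 2 / (volume P).toReal ≤ C / φ := by
  refine ⟨24, by norm_num, fun φ hφ P hP hc hne ⟨F, hF⟩ hsep => ?_⟩
  have hvol : 0 < (volume P).toReal :=
    ENNReal.toReal_pos (Measure.measure_pos_of_nonempty_interior _ hne).ne' hc.measure_lt_top.ne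
  rw [div_le_div_iff₀ hvol hφ.1, mul_comm]
  exact mul_diam_sq_le_volume hφ.1 hφ.2 hP hc hne hF hsep
end

section
/- Let P ⊂ ℝ² be a convex polygon with k vertices and let a ∈ (0, 1/2]. Then P can be partitioned by a single straight-line cut into two convex polygons P₁ and P₂ such that: each has at most k+1 vertices; area(P₁) = a·area(P) and area(P₂) = (1-a)·area(P); and max{ar(P₁), ar(P₂)} ≤ max{ar(P)·(1 + 6/k), k⁸}. -/
open MeasureTheory Real RealInnerProductSpace

/-- The aspect ratio of a planar convex region: `diam(A)^2 / area(A)`. -/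
noncomputable def aspectRatio (A : Set Plane) : ℝ :=
  (Metric.diam A) ^ 2 / (volume A).toReal

/-- The open standard triangle has area `1/2`. -/
lemma volume_standardTriangle :
    volume {x : Plane | 0 < x 0 ∧ x 0 < 1 ∧ 0 < x 1 ∧ x 1 < 1 - x 0} = ENNReal.ofReal (1 / 2) := by
  have hmp := (volume_preserving_finTwoArrow ℝ).comp (PiLp.volume_preserving_ofLp (Fin 2))
  have hset : {x : Plane | 0 < x 0 ∧ x 0 < 1 ∧ 0 < x 1 ∧ x 1 < 1 - x 0} =
      (MeasurableEquiv.finTwoArrow ∘ WithLp.ofLp) ⁻¹'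
        regionBetween (fun _ : ℝ => (0 : ℝ)) (fun x => 1 - x) (Set.Ioo 0 1) := by
    ext x
    simp [regionBetween, MeasurableEquiv.finTwoArrow, and_assoc]
  have hmeas : MeasurableSet
      (regionBetween (fun _ : ℝ => (0 : ℝ)) (fun x => 1 - x) (Set.Ioo 0 1)) :=
    measurableSet_regionBetween measurable_const (by fun_prop) measurableSet_Ioo
  rw [hset, hmp.measure_preimage hmeas.nullMeasurableSet, Measure.volume_eq_prod,
    volume_regionBetween_eq_integral]
  · congr 1
    rw [← integral_Ioc_eq_integral_Ioo, ← intervalIntegral.integral_of_le zero_le_one]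
    simp only [Pi.sub_apply, sub_zero]
    rw [intervalIntegral.integral_sub (by simp) (by simp)]
    simp
    norm_num
  · exact integrableOn_const (by simp)
  · have : ContinuousOn (fun x : ℝ => 1 - x) (Set.Icc 0 1) := by fun_prop
    exact (this.integrableOn_compact isCompact_Icc).mono_set Set.Ioo_subset_Icc_self
  · exact measurableSet_Ioo
  · intro x hx
    simpa using hx.2.le

/-- A planar convex set has at least the area of any triangle with vertices in it. -/
lemma Convex.abs_det_le_two_mul_volume {C : Set Plane} (hC : Convex ℝ C) (hfin : volume C ≠ ⊤)
    {x y z : Plane} (hx : x ∈ C) (hy : y ∈ C) (hz : z ∈ C) :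
    |(y 0 - x 0) * (z 1 - x 1) - (y 1 - x 1) * (z 0 - x 0)| ≤ 2 * (volume C).toReal := by
  let b := (EuclideanSpace.basisFun (Fin 2) ℝ).toBasis
  let M : Matrix (Fin 2) (Fin 2) ℝ := !![y 0 - x 0, z 0 - x 0; y 1 - x 1, z 1 - x 1]
  let f : Plane →ₗ[ℝ] Plane := Matrix.toLin b b M
  have hf : ∀ p : Plane, f p = p 0 • (y - x) + p 1 • (z - x) := by
    intro p
    ext i
    fin_cases i <;>
      simp [f, b, M, Matrix.toLin_apply, Matrix.mulVec, dotProduct, Fin.sum_univ_two] <;> ring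
  have hdet : LinearMap.det f =
      (y 0 - x 0) * (z 1 - x 1) - (y 1 - x 1) * (z 0 - x 0) := by
    simp only [f, LinearMap.det_toLin, M, Matrix.det_fin_two_of]
    ring
  have hvol := Measure.addHaar_image_linearMap (volume : Measure Plane) f
    {x : Plane | 0 < x 0 ∧ x 0 < 1 ∧ 0 < x 1 ∧ x 1 < 1 - x 0}
  have hsub : f '' {x : Plane | 0 < x 0 ∧ x 0 < 1 ∧ 0 < x 1 ∧ x 1 < 1 - x 0} ⊆
      (fun p => x + p) ⁻¹' C := by
    rintro _ ⟨p, ⟨h0, -, h1, h2⟩, rfl⟩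
    have key : x + f p = (1 - p 0 - p 1) • x + p 0 • y + p 1 • z := by
      rw [hf]
      module
    simp only [Set.mem_preimage]
    rw [key]
    have hmem := hC.sum_mem (t := Finset.univ) (w := ![1 - p 0 - p 1, p 0, p 1]) (z := ![x, y, z])
      (by intro i _; fin_cases i <;> simp <;> linarith)
      (by simp [Fin.sum_univ_three]; ring)
      (by intro i _; fin_cases i <;> simp [hx, hy, hz])
    simpa [Fin.sum_univ_three] using hmem
  have hle := measure_mono (μ := volume) hsub
  rw [measure_preimage_add, hvol, volume_standardTriangle, hdet,
    ← ENNReal.ofReal_mul (abs_nonneg _)] at hle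
  have := (ENNReal.ofReal_le_iff_le_toReal hfin).1 hle
  linarith

/-- Shrinking a set by the factor `r` towards a point scales the area by `r ^ 2`. -/
lemma sq_mul_volume_le_of_homothety {P Q : Set Plane} (hQ : volume Q ≠ ⊤) (v : Plane) (r : ℝ)
    (h : ∀ x ∈ P, v + r • (x - v) ∈ Q) :
    r ^ 2 * (volume P).toReal ≤ (volume Q).toReal := by
  have hvol := Measure.addHaar_image_homothety (volume : Measure Plane) v r P
  have hsub : AffineMap.homothety v r '' P ⊆ Q := by
    rintro _ ⟨x, hx, rfl⟩
    simpa [AffineMap.homothety_apply, add_comm] using h x hx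
  have hle := ENNReal.toReal_mono hQ (measure_mono (μ := volume) hsub)
  rw [hvol, ENNReal.toReal_mul, ENNReal.toReal_ofReal (abs_nonneg _)] at hle
  simpa using hle

lemma volume_setOf_inner_eq {n : Plane} (hn : n ≠ 0) (c : ℝ) :
    volume {x : Plane | ⟪n, x⟫ = c} = 0 := by
  rcases Set.eq_empty_or_nonempty {x : Plane | ⟪n, x⟫ = c} with h | ⟨x₀, hx₀⟩
  · simp [h]
  · have hset : {x : Plane | ⟪n, x⟫ = c} =
        (AffineSubspace.mk' x₀ (innerSL ℝ n).ker : AffineSubspace ℝ Plane) := by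
      ext x
      have hx₀' : ⟪n, x₀⟫ = c := hx₀
      simp [AffineSubspace.mem_mk', inner_sub_right, hx₀', sub_eq_zero]
    rw [hset]
    refine Measure.addHaar_affineSubspace _ _ fun htop => hn ?_
    have hmem : x₀ + n ∈ AffineSubspace.mk' x₀ (innerSL ℝ n).ker := by
      rw [htop]; trivial
    simpa [AffineSubspace.mem_mk'] using hmem

/-- A compact set can be cut in any given proportion by a line orthogonal to a given vector. -/
lemma IsCompact.exists_cut {P : Set Plane} (hP : IsCompact P) (hne : P.Nonempty) {n : Plane}
    (hn : n ≠ 0) {a : ℝ} (ha0 : 0 ≤ a) (ha1 : a ≤ 1) :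
    ∃ c : ℝ, (volume (P ∩ {x | ⟪n, x⟫ ≤ c})).toReal = a * (volume P).toReal ∧
      (volume (P ∩ {x | c ≤ ⟪n, x⟫})).toReal = (1 - a) * (volume P).toReal := by
  have hfin : volume P ≠ ⊤ := hP.measure_lt_top.ne
  have : IsFiniteMeasure (volume.restrict P) := ⟨by simpa using hP.measure_lt_top⟩
  have hcont : Continuous fun x : Plane => ⟪n, x⟫ := by fun_prop
  obtain ⟨p, hp, hpmin⟩ := hP.exists_isMinOn hne hcont.continuousOn
  obtain ⟨q, hq, hqmax⟩ := hP.exists_isMaxOn hne hcont.continuousOn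
  let μ := (volume.restrict P).map fun x : Plane => ⟪n, x⟫
  have hnull : ∀ c, (volume.restrict P) {x | ⟪n, x⟫ = c} = 0 := fun c =>
    le_antisymm ((Measure.restrict_apply_le _ _).trans (volume_setOf_inner_eq hn c).le) zero_le
  have : NullSingletonClass μ := ⟨fun c => by
    rw [Measure.map_apply hcont.measurable (measurableSet_singleton c)]
    exact hnull c⟩
  let lo := ⟪n, p⟫ - 1
  let g : ℝ → ℝ := fun b => ∫ _ in lo..b, (1 : ℝ) ∂μ
  have hg : Continuous g := intervalIntegral.continuous_primitive (fun _ _ => by simp) lo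
  have hgval : ∀ c, lo ≤ c → g c = (volume (P ∩ {x | ⟪n, x⟫ ≤ c})).toReal := by
    intro c hc
    have h1 : g c = (μ (Set.Ioc lo c)).toReal := by
      simp [g, intervalIntegral.integral_of_le hc, Measure.real]
    rw [h1, Measure.map_apply hcont.measurable measurableSet_Ioc,
      Measure.restrict_apply (hcont.measurable measurableSet_Ioc)]
    congr 2
    ext x
    simp only [Set.mem_inter_iff, Set.mem_preimage, Set.mem_Ioc, Set.mem_ofPred_eq]
    constructor
    · rintro ⟨⟨-, h⟩, hx⟩
      exact ⟨hx, h⟩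
    · rintro ⟨hx, h⟩
      have : ⟪n, p⟫ ≤ ⟪n, x⟫ := hpmin hx
      exact ⟨⟨by simp only [lo]; linarith, h⟩, hx⟩
  have hlo : lo ≤ ⟪n, q⟫ := by
    have : ⟪n, p⟫ ≤ ⟪n, q⟫ := hpmin hq
    simp only [lo]; linarith
  have hgq : g ⟪n, q⟫ = (volume P).toReal := by
    rw [hgval _ hlo]
    congr 2
    exact Set.inter_eq_left.2 fun x hx => hqmax hx
  have hglo : g lo = 0 := by simp [g]
  obtain ⟨c, hc, hgc⟩ := intermediate_value_Icc hlo hg.continuousOn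
    (show a * (volume P).toReal ∈ Set.Icc (g lo) (g ⟪n, q⟫) by
      rw [hglo, hgq]
      have := ENNReal.toReal_nonneg (a := volume P)
      exact ⟨by positivity, by nlinarith⟩)
  refine ⟨c, (hgval c hc.1).symm.trans hgc, ?_⟩
  have hle : MeasurableSet {x : Plane | ⟪n, x⟫ ≤ c} := measurableSet_le hcont.measurable (by simp)
  have hsplit := measure_inter_add_sdiff (μ := volume) P hle
  have hae : volume (P \ {x | ⟪n, x⟫ ≤ c}) = volume (P ∩ {x | c ≤ ⟪n, x⟫}) := by
    refine le_antisymm (measure_mono fun x hx => ⟨hx.1, ?_⟩) ?_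
    · exact (not_le.1 fun h : ⟪n, x⟫ ≤ c => hx.2 h).le
    have hsub : P ∩ {x | c ≤ ⟪n, x⟫} ⊆ (P \ {x | ⟪n, x⟫ ≤ c}) ∪ {x | ⟪n, x⟫ = c} := by
      rintro x ⟨hx, hxc⟩
      have hcx : c ≤ ⟪n, x⟫ := hxc
      rcases eq_or_lt_of_le hcx with h | h
      · exact Or.inr h.symm
      · exact Or.inl ⟨hx, not_le.2 h⟩
    refine (measure_mono hsub).trans ((measure_union_le _ _).trans ?_)
    rw [volume_setOf_inner_eq hn, add_zero]
  rw [hae] at hsplit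
  have h2 := congrArg ENNReal.toReal hsplit
  rw [ENNReal.toReal_add (measure_ne_top_of_subset Set.inter_subset_left hfin)
    (measure_ne_top_of_subset Set.inter_subset_left hfin), ← hgval c hc.1, hgc] at h2
  linarith

/-- Cutting the convex hull of `k` points with a half-plane yields the convex hull of at most
`k + 1` points, provided that some point is cut off. -/
lemma exists_finset_convexHull_inter_le (V : Finset Plane) (n : Plane) (c : ℝ)
    (hc : (convexHull ℝ (V : Set Plane) ∩ {x | ⟪n, x⟫ ≤ c}).Nonempty) (hn : n ≠ 0) :
    ∃ W : Finset Plane, convexHull ℝ (V : Set Plane) ∩ {x | ⟪n, x⟫ ≤ c} =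
      convexHull ℝ (W : Set Plane) ∧ W.card ≤ V.card + 1 := by
  classical
  have hcont : Continuous fun x : Plane => ⟪n, x⟫ := by fun_prop
  have hlin : IsLinearMap ℝ fun x : Plane => ⟪n, x⟫ :=
    ⟨fun x y => inner_add_right n x y, fun r x => by simp [inner_smul_right]⟩
  have hconvle : Convex ℝ {x : Plane | ⟪n, x⟫ ≤ c} := convex_halfSpace_le hlin c
  set A := V.filter fun x => ⟪n, x⟫ ≤ c with hA
  set B := V.filter fun x => ¬ ⟪n, x⟫ ≤ c with hB
  have hAV : (A : Set Plane) ⊆ V := Finset.coe_subset.2 (Finset.filter_subset _ _)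
  have hunion : (A : Set Plane) ∪ B = V := by
    rw [← Finset.coe_union, Finset.filter_union_filter_not_eq]
  have hcard : A.card + B.card = V.card := Finset.card_filter_add_card_filter_not _
  have hAle : (A : Set Plane) ⊆ {x | ⟪n, x⟫ ≤ c} := fun x hx => by
    simpa using (Finset.mem_filter.1 (Finset.mem_coe.1 hx)).2
  have hBge : convexHull ℝ (B : Set Plane) ⊆ {x | c < ⟪n, x⟫} :=
    convexHull_min (fun x hx => by
      simpa using (Finset.mem_filter.1 (Finset.mem_coe.1 hx)).2) (convex_halfSpace_gt hlin c)
  rcases B.eq_empty_or_nonempty with hBe | hBne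
  · refine ⟨V, Set.inter_eq_left.2 ?_, by omega⟩
    have : (V : Set Plane) ⊆ {x | ⟪n, x⟫ ≤ c} := by
      rw [← hunion, hBe]; simpa using hAle
    exact convexHull_min this hconvle
  have hB1 : 1 ≤ B.card := hBne.card_pos
  have hAne : A.Nonempty := by
    by_contra hAe
    rw [Finset.not_nonempty_iff_eq_empty] at hAe
    obtain ⟨x, hxV, hxc⟩ := hc
    rw [← hunion, hAe] at hxV
    have := hBge (by simpa using hxV)
    simp only [Set.mem_ofPred_eq] at this hxc
    linarith
  have hjoin : convexHull ℝ (V : Set Plane) =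
      convexJoin ℝ (convexHull ℝ (A : Set Plane)) (convexHull ℝ (B : Set Plane)) := by
    rw [← hunion, convexHull_union (𝕜 := ℝ) (by simpa using hAne) (by simpa using hBne)]
  let d : Plane := !₂[-n 1, n 0]
  have hdcont : Continuous fun x : Plane => ⟪d, x⟫ := by fun_prop
  let L : Set Plane := convexHull ℝ (V : Set Plane) ∩ {x | ⟪n, x⟫ = c}
  have hLcomp : IsCompact L :=
    (V.finite_toSet.isCompact_convexHull (𝕜 := ℝ)).inter_right (isClosed_eq hcont continuous_const)
  have hcross : ∀ u ∈ convexHull ℝ (A : Set Plane), ∀ w ∈ convexHull ℝ (B : Set Plane),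
      ∃ z ∈ L, ∀ x ∈ segment ℝ u w, ⟪n, x⟫ ≤ c → x ∈ segment ℝ u z := by
    intro u hu w hw
    have huc : ⟪n, u⟫ ≤ c := convexHull_min hAle hconvle hu
    have hwc : c < ⟪n, w⟫ := hBge hw
    set s := (c - ⟪n, u⟫) / (⟪n, w⟫ - ⟪n, u⟫) with hs
    have hpos : 0 < ⟪n, w⟫ - ⟪n, u⟫ := by linarith
    have hs0 : 0 ≤ s := div_nonneg (by linarith) hpos.le
    have hs1 : s ≤ 1 := (div_le_one hpos).2 (by linarith)
    have hsmul : s * (⟪n, w⟫ - ⟪n, u⟫) = c - ⟪n, u⟫ := div_mul_cancel₀ _ hpos.ne'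
    have huP : u ∈ convexHull ℝ (V : Set Plane) := convexHull_mono hAV hu
    have hwP : w ∈ convexHull ℝ (V : Set Plane) :=
      convexHull_mono (Finset.coe_subset.2 (Finset.filter_subset _ _)) hw
    refine ⟨u + s • (w - u), ⟨?_, ?_⟩, ?_⟩
    · exact (convex_convexHull ℝ _).add_smul_sub_mem huP hwP ⟨hs0, hs1⟩
    · simp only [Set.mem_ofPred_eq, inner_add_right, inner_smul_right, inner_sub_right]
      linarith
    · intro x hx hxc
      rw [segment_eq_image'] at hx ⊢
      obtain ⟨θ, ⟨hθ0, hθ1⟩, rfl⟩ := hx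
      simp only [inner_add_right, inner_smul_right, inner_sub_right] at hxc
      have hθs : θ ≤ s := by
        rw [hs, le_div_iff₀ hpos]; linarith
      rcases hs0.eq_or_lt with h0 | h0
      · have : θ = 0 := by linarith
        exact ⟨0, by simp, by simp [this]⟩
      · refine ⟨θ / s, ⟨by positivity, (div_le_one h0).2 hθs⟩, ?_⟩
        simp only [add_sub_cancel_left, smul_smul, div_mul_cancel₀ _ h0.ne']
  obtain ⟨u₀, hu₀⟩ := hAne
  obtain ⟨w₀, hw₀⟩ := hBne
  obtain ⟨z₀, hz₀, -⟩ := hcross u₀ (subset_convexHull ℝ _ hu₀) w₀ (subset_convexHull ℝ _ hw₀)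
  obtain ⟨p, hp, hpmin⟩ := hLcomp.exists_isMinOn ⟨z₀, hz₀⟩ hdcont.continuousOn
  obtain ⟨q, hq, hqmax⟩ := hLcomp.exists_isMaxOn ⟨z₀, hz₀⟩ hdcont.continuousOn
  have hLseg : L ⊆ segment ℝ p q := by
    intro z hz
    have h1 : ⟪d, p⟫ ≤ ⟪d, z⟫ := hpmin hz
    have h2 : ⟪d, z⟫ ≤ ⟪d, q⟫ := hqmax hz
    have hz' : ⟪n, z⟫ = c := hz.2
    have hp' : ⟪n, p⟫ = c := hp.2
    have hq' : ⟪n, q⟫ = c := hq.2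
    have hnn : 0 < n 0 ^ 2 + n 1 ^ 2 := by
      by_contra hcon
      have h0 : n 0 = 0 := by nlinarith [sq_nonneg (n 0), sq_nonneg (n 1)]
      have h1 : n 1 = 0 := by nlinarith [sq_nonneg (n 0), sq_nonneg (n 1)]
      apply hn
      ext i
      fin_cases i <;> simp [h0, h1]
    have hrec : ∀ x y : Plane, ⟪n, x⟫ = ⟪n, y⟫ → ⟪d, x⟫ = ⟪d, y⟫ → x = y := by
      intro x y h1 h2
      simp only [d, PiLp.inner_apply, Fin.sum_univ_two, RCLike.inner_apply, conj_trivial,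
        Matrix.cons_val_zero, Matrix.cons_val_one] at h1 h2
      ext i
      fin_cases i
      · refine mul_left_cancel₀ hnn.ne' ?_
        simp only [Fin.zero_eta]
        linear_combination n 0 * h1 - n 1 * h2
      · refine mul_left_cancel₀ hnn.ne' ?_
        simp only [Fin.mk_one]
        linear_combination n 1 * h1 + n 0 * h2
    rw [segment_eq_image']
    rcases (h1.trans h2).eq_or_lt with h | h
    · refine ⟨0, by simp, ?_⟩
      simp only [zero_smul, add_zero]
      exact hrec _ _ (by rw [hp', hz']) (by linarith)
    · have hpos : 0 < ⟪d, q⟫ - ⟪d, p⟫ := by linarith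
      refine ⟨(⟪d, z⟫ - ⟪d, p⟫) / (⟪d, q⟫ - ⟪d, p⟫),
        ⟨div_nonneg (by linarith) hpos.le, (div_le_one hpos).2 (by linarith)⟩, ?_⟩
      apply hrec
      · simp [inner_add_right, inner_smul_right, inner_sub_right, hp', hq', hz']
      · simp only [inner_add_right, inner_smul_right, inner_sub_right]
        rw [div_mul_cancel₀ _ hpos.ne']
        ring
  refine ⟨A ∪ {p, q}, Set.Subset.antisymm ?_ ?_, ?_⟩
  · rintro x ⟨hx, hxc⟩
    rw [hjoin, mem_convexJoin] at hx
    obtain ⟨u, hu, w, hw, hxs⟩ := hx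
    obtain ⟨z, hz, hseg⟩ := hcross u hu w hw
    have hAW : (A : Set Plane) ⊆ ((A ∪ {p, q} : Finset Plane) : Set Plane) :=
      Finset.coe_subset.2 Finset.subset_union_left
    have huW := convexHull_mono (𝕜 := ℝ) hAW hu
    have hzW : z ∈ convexHull ℝ ((A ∪ {p, q} : Finset Plane) : Set Plane) :=
      (convex_convexHull ℝ _).segment_subset (subset_convexHull ℝ _ (by simp))
        (subset_convexHull ℝ _ (by simp)) (hLseg hz)
    exact (convex_convexHull ℝ _).segment_subset huW hzW (hseg x hxs hxc)
  · refine convexHull_min ?_ ((convex_convexHull ℝ _).inter hconvle)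
    intro x hx
    simp only [Finset.coe_union, Finset.coe_insert, Finset.coe_singleton, Set.mem_union,
      Set.mem_insert_iff, Set.mem_singleton_iff] at hx
    rcases hx with hx | rfl | rfl
    · exact ⟨subset_convexHull ℝ _ (hAV hx), hAle hx⟩
    · exact ⟨hp.1, hp.2.le⟩
    · exact ⟨hq.1, hq.2.le⟩
  · have h1 := Finset.card_union_le A {p, q}
    have h2 : ({p, q} : Finset Plane).card ≤ 2 := Finset.card_le_two
    omega

lemma exists_finset_convexHull_inter_ge (V : Finset Plane) (n : Plane) (c : ℝ)
    (hc : (convexHull ℝ (V : Set Plane) ∩ {x | c ≤ ⟪n, x⟫}).Nonempty) (hn : n ≠ 0) :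
    ∃ W : Finset Plane, convexHull ℝ (V : Set Plane) ∩ {x | c ≤ ⟪n, x⟫} =
      convexHull ℝ (W : Set Plane) ∧ W.card ≤ V.card + 1 := by
  have hset : {x : Plane | c ≤ ⟪n, x⟫} = {x | ⟪-n, x⟫ ≤ -c} := by
    ext x
    simp [inner_neg_left]
  rw [hset] at hc ⊢
  exact exists_finset_convexHull_inter_le V (-n) (-c) hc (neg_ne_zero.2 hn)

/-- Among `k + 1` directions, two have the same supporting vertex, so in the coordinates `X`, `Y`
the polygon lies in a cone of aperture bounded away from `π` at that vertex. -/
lemma exists_vertex_cone (V : Finset Plane) (hV : V.Nonempty) (X Y : Plane →ₗ[ℝ] ℝ) :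
    ∃ v ∈ V, ∃ m : ℝ, |m| ≤ 1 ∧ ∀ x ∈ convexHull ℝ (V : Set Plane),
      |Y (x - v)| ≤ V.card * (X (x - v) - m * Y (x - v)) := by
  have hk : (0 : ℝ) < V.card := by exact_mod_cast hV.card_pos
  set k := V.card
  let μ : Fin (k + 1) → ℝ := fun i => -1 + 2 * (i : ℝ) / k
  have hμ0 : ∀ i, -1 ≤ μ i := fun i => by
    have : 0 ≤ 2 * (i : ℝ) / k := by positivity
    simp only [μ]; linarith
  have hμ1 : ∀ i, μ i ≤ 1 := fun i => by
    have hi : (i : ℝ) ≤ k := by exact_mod_cast Nat.lt_succ_iff.1 i.2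
    have : 2 * (i : ℝ) / k ≤ 2 := by rw [div_le_iff₀ hk]; linarith
    simp only [μ]; linarith
  have hmin : ∀ i, ∃ v ∈ V, ∀ x ∈ V, X v - μ i * Y v ≤ X x - μ i * Y x := fun i =>
    V.exists_min_image _ hV
  choose w hwV hw using hmin
  obtain ⟨i, -, j, -, hij, hwij⟩ := Finset.exists_ne_map_eq_of_card_lt_of_maps_to
    (s := Finset.univ) (t := V) (f := w) (by simp [k]) (fun i _ => hwV i)
  wlog hlt : i < j generalizing i j
  · exact this j i hij.symm hwij.symm (lt_of_le_of_ne (not_lt.1 hlt) hij.symm)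
  have hhull : ∀ l, ∀ x ∈ convexHull ℝ (V : Set Plane),
      X (w l) - μ l * Y (w l) ≤ X x - μ l * Y x := by
    intro l x hx
    have hconv : Convex ℝ {x : Plane | X (w l) - μ l * Y (w l) ≤ (X - μ l • Y) x} :=
      convex_halfSpace_ge (X - μ l • Y).isLinear _
    have := convexHull_min (s := (V : Set Plane)) (fun y hy => by simpa using hw l y hy) hconv hx
    simpa using this
  refine ⟨w i, hwV i, (μ i + μ j) / 2, ?_, fun x hx => ?_⟩
  · rw [abs_le]
    constructor <;> linarith [hμ0 i, hμ0 j, hμ1 i, hμ1 j]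
  · have h1 := hhull i x hx
    have h2 := hhull j x hx
    rw [← hwij] at h2
    have hδ : 2 ≤ k * (μ j - μ i) := by
      have h3 : (i : ℝ) + 1 ≤ j := by exact_mod_cast hlt
      have h4 : k * (μ j - μ i) = 2 * j - 2 * i := by
        simp only [μ]; field_simp; ring
      linarith
    simp only [map_sub]
    have h5 : 0 ≤ k * (X x - X (w i) - μ i * (Y x - Y (w i))) :=
      mul_nonneg hk.le (by linarith)
    have h6 : 0 ≤ k * (X x - X (w i) - μ j * (Y x - Y (w i))) :=
      mul_nonneg hk.le (by linarith)
    rcases abs_cases (Y x - Y (w i)) with ⟨h, h0⟩ | ⟨h, h0⟩ <;> rw [h] <;> nlinarith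

/-- Rotated coordinates in which `q - p` is horizontal. -/
lemma exists_rotated_coordinates {p q : Plane} (hpq : p ≠ q) :
    ∃ X Y : Plane →ₗ[ℝ] ℝ, (∀ x, ‖x‖ ^ 2 = X x ^ 2 + Y x ^ 2) ∧
      (∀ u w, X u * Y w - Y u * X w = u 0 * w 1 - u 1 * w 0) ∧
      X (q - p) = dist p q ∧ Y (q - p) = 0 ∧
      ∀ m : ℝ, ∃ n : Plane, n ≠ 0 ∧ ∀ x, ⟪n, x⟫ = X x - m * Y x := by
  have hD : 0 < dist p q := dist_pos.2 hpq
  have hDsq : dist p q ^ 2 = (q 0 - p 0) ^ 2 + (q 1 - p 1) ^ 2 := by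
    rw [dist_comm, EuclideanSpace.dist_eq, Real.sq_sqrt (by positivity)]
    simp [Fin.sum_univ_two, Real.dist_eq]
  set D := dist p q
  set c := (q 0 - p 0) / D with hc
  set s := (q 1 - p 1) / D with hs
  have hcD : c * D = q 0 - p 0 := div_mul_cancel₀ _ hD.ne'
  have hsD : s * D = q 1 - p 1 := div_mul_cancel₀ _ hD.ne'
  have hcs : c ^ 2 + s ^ 2 = 1 := by
    rw [hc, hs, div_pow, div_pow, ← add_div, ← hDsq, div_self (by positivity)]
  let π₀ : Plane →ₗ[ℝ] ℝ := (EuclideanSpace.proj (𝕜 := ℝ) (0 : Fin 2)).toLinearMap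
  let π₁ : Plane →ₗ[ℝ] ℝ := (EuclideanSpace.proj (𝕜 := ℝ) (1 : Fin 2)).toLinearMap
  let X : Plane →ₗ[ℝ] ℝ := c • π₀ + s • π₁
  let Y : Plane →ₗ[ℝ] ℝ := c • π₁ - s • π₀
  have hX : ∀ x, X x = c * x 0 + s * x 1 := fun x => by simp [X, π₀, π₁]
  have hY : ∀ x, Y x = c * x 1 - s * x 0 := fun x => by simp [Y, π₀, π₁]
  have hXqp : X (q - p) = D := by
    rw [hX, PiLp.sub_apply, PiLp.sub_apply, ← hcD, ← hsD]
    linear_combination D * hcs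
  have hYqp : Y (q - p) = 0 := by
    rw [hY, PiLp.sub_apply, PiLp.sub_apply, ← hcD, ← hsD]
    ring
  refine ⟨X, Y, fun x => ?_, fun u w => ?_, hXqp, hYqp, fun m => ?_⟩
  · rw [EuclideanSpace.real_norm_sq_eq, Fin.sum_univ_two, hX, hY]
    linear_combination -(x 0 ^ 2 + x 1 ^ 2) * hcs
  · rw [hX, hX, hY, hY]
    linear_combination (u 0 * w 1 - u 1 * w 0) * hcs
  · have hn : ∀ x, ⟪(!₂[c + m * s, s - m * c] : Plane), x⟫ = X x - m * Y x := by
      intro x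
      rw [hX, hY]
      simp only [PiLp.inner_apply, Fin.sum_univ_two, RCLike.inner_apply, conj_trivial,
        Matrix.cons_val_zero, Matrix.cons_val_one]
      ring
    refine ⟨_, fun h0 => hD.ne' ?_, hn⟩
    have := hn (q - p)
    rw [h0, inner_zero_left, hXqp, hYqp] at this
    linarith

section Cap

variable {X Y : Plane →ₗ[ℝ] ℝ} {P : Set Plane} {v q : Plane} {m h k D : ℝ}

lemma dist_sq_le_of_mem_cap (hnorm : ∀ x, ‖x‖ ^ 2 = X x ^ 2 + Y x ^ 2) (hm : |m| ≤ 1)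
    (hk : 0 < k) (hcone : ∀ x ∈ P, |Y (x - v)| ≤ k * (X (x - v) - m * Y (x - v)))
    {x y : Plane} (hx : x ∈ P) (hxh : X (x - v) - m * Y (x - v) ≤ h)
    (hy : y ∈ P) (hyh : X (y - v) - m * Y (y - v) ≤ h) :
    dist x y ^ 2 ≤ (8 * k ^ 2 + 4 * k + 1) * h ^ 2 := by
  have hcx := hcone x hx
  have hcy := hcone y hy
  have hx0 : 0 ≤ X (x - v) - m * Y (x - v) :=
    nonneg_of_mul_nonneg_right ((abs_nonneg _).trans hcx) hk
  have hy0 : 0 ≤ X (y - v) - m * Y (y - v) :=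
    nonneg_of_mul_nonneg_right ((abs_nonneg _).trans hcy) hk
  have hxy : x - y = (x - v) - (y - v) := by abel
  have hYd : |Y (x - y)| ≤ 2 * k * h := by
    rw [hxy, map_sub]
    refine (abs_sub _ _).trans ?_
    nlinarith
  have hXd : |X (x - y)| ≤ (1 + 2 * k) * h := by
    have h1 : X (x - y) = ((X (x - v) - m * Y (x - v)) - (X (y - v) - m * Y (y - v))) +
        m * Y (x - y) := by
      simp only [map_sub]; ring
    rw [h1]
    refine (abs_add_le _ _).trans ?_
    have h2 : |(X (x - v) - m * Y (x - v)) - (X (y - v) - m * Y (y - v))| ≤ h := by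
      rw [abs_le]; constructor <;> linarith
    have h3 : |m * Y (x - y)| ≤ 2 * k * h := by
      rw [abs_mul]
      exact (mul_le_of_le_one_left (abs_nonneg _) hm).trans hYd
    linarith
  rw [dist_eq_norm, hnorm]
  have h4 := sq_le_sq' (neg_le_of_abs_le hYd) (le_of_abs_le hYd)
  have h5 := sq_le_sq' (neg_le_of_abs_le hXd) (le_of_abs_le hXd)
  nlinarith

/-- A cap of small area is close to a segment. -/
lemma dist_le_of_mem_cap (hnorm : ∀ x, ‖x‖ ^ 2 = X x ^ 2 + Y x ^ 2)
    (hdet : ∀ u w : Plane, X u * Y w - Y u * X w = u 0 * w 1 - u 1 * w 0) (hm : |m| ≤ 1)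
    (hP : Convex ℝ P) (hPfin : volume P ≠ ⊤) (hv : v ∈ P) (hq : q ∈ P) (hqD : dist q v ≤ D)
    (hpos : ∀ x ∈ P, 0 ≤ X (x - v) - m * Y (x - v)) (hh : 0 < h)
    (hhq : h ≤ X (q - v) - m * Y (q - v))
    {C : Set Plane} (hC : ∀ x, x ∈ C ↔ x ∈ P ∧ X (x - v) - m * Y (x - v) ≤ h)
    {x y : Plane} (hx : x ∈ C) (hy : y ∈ C) :
    dist x y ≤ h / (X (q - v) - m * Y (q - v)) * D + 6 * (volume C).toReal / h := by
  set τ := X (q - v) - m * Y (q - v) with hτ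
  have hτ0 : 0 < τ := hh.trans_le hhq
  have hCfin : volume C ≠ ⊤ := measure_ne_top_of_subset (fun x hx => ((hC x).1 hx).1) hPfin
  have hCconv : Convex ℝ C := by
    intro a ha b hb α β hα hβ hαβ
    rw [hC] at ha hb ⊢
    refine ⟨hP ha.1 hb.1 hα hβ hαβ, ?_⟩
    have h1 : α • a + β • b - v = α • (a - v) + β • (b - v) := by
      rw [smul_sub, smul_sub, sub_add_sub_comm, ← add_smul, hαβ, one_smul]
    rw [h1]
    simp only [map_add, map_smul, smul_eq_mul]
    nlinarith [mul_le_mul_of_nonneg_left ha.2 hα, mul_le_mul_of_nonneg_left hb.2 hβ]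
  set S := (volume C).toReal
  let g := v + (h / τ) • (q - v)
  have hgv : g - v = (h / τ) • (q - v) := by simp [g]
  have hvC : v ∈ C := (hC v).2 ⟨hv, by simpa using hh.le⟩
  have hgC : g ∈ C := by
    refine (hC g).2 ⟨hP.add_smul_sub_mem hv hq ⟨by positivity, (div_le_one hτ0).2 hhq⟩, ?_⟩
    rw [hgv]
    simp only [map_smul, smul_eq_mul]
    have : h / τ * X (q - v) - m * (h / τ * Y (q - v)) = h / τ * τ := by rw [hτ]; ring
    rw [this, div_mul_cancel₀ _ hτ0.ne']
  have hstrip : ∀ z ∈ C,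
      |Y (z - v) - (X (z - v) - m * Y (z - v)) / τ * Y (q - v)| ≤ 2 * S / h := by
    intro z hz
    have h1 := hCconv.abs_det_le_two_mul_volume hCfin hvC hz hgC
    simp only [← PiLp.sub_apply] at h1
    rw [← hdet, hgv] at h1
    simp only [map_smul, smul_eq_mul] at h1
    rw [le_div_iff₀ hh]
    have habs : ∀ u : ℝ, |u| * h = |-(u * h)| := fun u => by
      rw [abs_neg, abs_mul, abs_of_pos hh]
    refine le_trans (le_of_eq ?_) h1
    rw [habs]
    congr 1
    have h2 : X (q - v) = τ + m * Y (q - v) := by rw [hτ]; ring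
    rw [h2]
    field_simp
    ring
  have hx' := (hC x).1 hx
  have hy' := (hC y).1 hy
  have hx0 := hpos x hx'.1
  have hy0 := hpos y hy'.1
  set δx := Y (x - v) - (X (x - v) - m * Y (x - v)) / τ * Y (q - v) with hδx
  set δy := Y (y - v) - (X (y - v) - m * Y (y - v)) / τ * Y (q - v) with hδy
  have hδ : |δx - δy| ≤ 4 * S / h := by
    refine (abs_sub _ _).trans ((add_le_add (hstrip x hx) (hstrip y hy)).trans (le_of_eq ?_))
    ring
  set σ := ((X (x - v) - m * Y (x - v)) - (X (y - v) - m * Y (y - v))) / τ with hσ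
  have hσh : |σ| ≤ h / τ := by
    rw [hσ, abs_div, abs_of_pos hτ0]
    gcongr
    rw [abs_le]
    constructor <;> linarith [hx'.2, hy'.2]
  let z := (x - y) - σ • (q - v)
  have hxy : x - y = (x - v) - (y - v) := by abel
  have hYz : Y z = δx - δy := by
    simp only [z]
    rw [hxy]
    simp only [map_sub Y (x - v), map_sub Y ((x - v) - (y - v)), map_smul, smul_eq_mul]
    rw [hδx, hδy, hσ]
    ring
  have hXz : X z = m * (δx - δy) := by
    have h2 : X (q - v) = τ + m * Y (q - v) := by rw [hτ]; ring
    simp only [z]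
    rw [hxy]
    simp only [map_sub X (x - v), map_sub X ((x - v) - (y - v)), map_smul, smul_eq_mul]
    rw [h2, hδx, hδy, hσ]
    field_simp
    ring
  have hS0 : 0 ≤ S := ENNReal.toReal_nonneg
  have hz : ‖z‖ ≤ 6 * S / h := by
    refine le_of_sq_le_sq ?_ (by positivity)
    rw [hnorm, hXz, hYz]
    have h3 := sq_le_sq' (neg_le_of_abs_le hδ) (le_of_abs_le hδ)
    have h4 : m ^ 2 ≤ 1 := by rw [sq_le_one_iff_abs_le_one]; exact hm
    have h5 : (6 * S / h) ^ 2 = 9 / 4 * (4 * S / h) ^ 2 := by ring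
    nlinarith [mul_le_mul_of_nonneg_right h4 (sq_nonneg (δx - δy))]
  have hsum : x - y = σ • (q - v) + z := by simp [z]
  rw [dist_eq_norm, hsum]
  refine (norm_add_le _ _).trans (add_le_add ?_ hz)
  rw [norm_smul, Real.norm_eq_abs, ← dist_eq_norm]
  exact mul_le_mul hσh hqD dist_nonneg (by positivity)

end Cap

lemma narrow_cap_estimate {k d h τ T D A a H : ℝ} (hk : 3 ≤ k) (hd : 0 ≤ d) (hh : 0 < h)
    (hD : 0 < D) (hA : 0 ≤ A) (ha : 0 ≤ a) (hhT : h ^ 2 ≤ a * T ^ 2) (hT0 : 0 ≤ T)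
    (hT : T ≤ τ + H) (hτ : D ≤ τ) (hH : 243 * k * H ≤ 40 * D)
    (hS : a * A * k ^ 8 < d ^ 2) (hdh : d ^ 2 ≤ 10 * k ^ 2 * h ^ 2)
    (hdle : d ≤ h / τ * D + 6 * (a * A) / h) :
    d ^ 2 ≤ (1 + 6 / k) * (a * D ^ 2) := by
  have hk0 : 0 < k := by linarith
  have hτ0 : 0 < τ := by linarith
  set e := 1 / k with he
  have he0 : 0 < e := by positivity
  have he3 : e ≤ 1 / 3 := by rw [he]; gcongr
  have hek : e * k = 1 := by rw [he]; field_simp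
  have h1 : d ≤ 3.2 * k * h := by
    refine le_of_sq_le_sq (hdh.trans ?_) (by positivity)
    nlinarith [sq_nonneg (k * h)]
  have h2 : 6 * (a * A) / h ≤ 0.03 * e * d := by
    rw [div_le_iff₀ hh]
    have h3 : a * A * k ^ 8 ≤ 3.2 * d * h * k := by nlinarith
    have h4 : a * A * k ^ 7 ≤ 3.2 * d * h := by
      refine le_of_mul_le_mul_right ?_ hk0
      linarith [h3, show a * A * k ^ 7 * k = a * A * k ^ 8 by ring]
    have h5 : (729 : ℝ) ≤ k ^ 6 := by
      calc (729 : ℝ) = 3 ^ 6 := by norm_num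
        _ ≤ k ^ 6 := by gcongr
    have h6 : a * A * (729 * k) ≤ a * A * k ^ 7 := by
      have : 729 * k ≤ k ^ 7 := by
        calc 729 * k ≤ k ^ 6 * k := by gcongr
          _ = k ^ 7 := by ring
      gcongr
    have h7 : a * A * 729 ≤ 3.2 * (d * h) * e := by
      have := mul_le_mul_of_nonneg_right (h6.trans h4) he0.le
      linarith [show a * A * (729 * k) * e = a * A * 729 * (e * k) by ring,
        show a * A * 729 * (e * k) = a * A * 729 by rw [hek, mul_one]]
    have h8 : 0 ≤ d * h * e := by positivity
    nlinarith
  have h9 : H ≤ 0.17 * e * D := by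
    have := mul_le_mul_of_nonneg_right hH he0.le
    nlinarith [show 243 * k * H * e = 243 * H * (e * k) by ring, mul_pos he0 hD]
  have h10 : T / τ ≤ 1 + 0.17 * e := by
    rw [div_le_iff₀ hτ0]
    nlinarith
  have h11 : (h / τ * D) ^ 2 ≤ a * D ^ 2 * (1 + 0.17 * e) ^ 2 := by
    have h12 : (T / τ) ^ 2 ≤ (1 + 0.17 * e) ^ 2 := by gcongr
    calc (h / τ * D) ^ 2 = h ^ 2 * (D / τ) ^ 2 := by ring
      _ ≤ a * T ^ 2 * (D / τ) ^ 2 := by gcongr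
      _ = a * D ^ 2 * (T / τ) ^ 2 := by ring
      _ ≤ _ := by gcongr
  have h13 : (d * (1 - 0.03 * e)) ^ 2 ≤ (h / τ * D) ^ 2 := by
    have : 0 ≤ d * (1 - 0.03 * e) := mul_nonneg hd (by linarith)
    exact pow_le_pow_left₀ this (by linarith) 2
  have h14 : (1 + 0.17 * e) ^ 2 ≤ (1 + 6 * e) * (1 - 0.03 * e) ^ 2 := by
    nlinarith [pow_pos he0 2, pow_pos he0 3]
  have h15 : 0 < (1 - 0.03 * e) ^ 2 := by
    have : 0 < 1 - 0.03 * e := by linarith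
    positivity
  have h16 : (6 : ℝ) / k = 6 * e := by rw [he]; ring
  rw [h16]
  refine le_of_mul_le_mul_right ?_ h15
  have h17 : a * D ^ 2 * (1 + 0.17 * e) ^ 2 ≤ a * D ^ 2 * ((1 + 6 * e) * (1 - 0.03 * e) ^ 2) := by
    gcongr
  nlinarith

lemma remaining_piece_estimate {k d h T D b H : ℝ} (hk : 3 ≤ k) (hd : 0 ≤ d)
    (hD : 0 < D) (hb : 1 / 2 ≤ b) (hhT : (T - h) ^ 2 ≤ b * T ^ 2) (hT0 : 0 ≤ T)
    (hT : T ≤ D + 2 * H) (hH0 : 0 ≤ H) (hH : 243 * k * H ≤ 40 * D)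
    (hdle : d ≤ (T - h) + 4 * H) :
    d ^ 2 ≤ (1 + 6 / k) * (b * D ^ 2) := by
  have hk0 : 0 < k := by linarith
  set e := 1 / k with he
  have he0 : 0 < e := by positivity
  have he3 : e ≤ 1 / 3 := by rw [he]; gcongr
  have hek : e * k = 1 := by rw [he]; field_simp
  have hr : √b ^ 2 = b := Real.sq_sqrt (by linarith)
  have hr0 : 2 / 3 ≤ √b := Real.le_sqrt_of_sq_le (by linarith)
  set r := √b
  have h1 : T - h ≤ r * T := by
    refine le_of_sq_le_sq ?_ (by positivity)
    rw [mul_pow, hr]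
    exact hhT
  have h2 : 8 * H ≤ 1.32 * e * D := by
    have := mul_le_mul_of_nonneg_right hH he0.le
    nlinarith [show 243 * k * H * e = 243 * H * (e * k) by ring, mul_pos he0 hD]
  have h3 : d ≤ r * (D * (1 + 1.32 * e)) := by
    calc d ≤ r * T + 4 * H := by linarith
      _ ≤ r * (D + 8 * H) := by nlinarith
      _ ≤ _ := by
        gcongr
        linarith
  have h4 : (1 + 1.32 * e) ^ 2 ≤ 1 + 6 * e := by nlinarith
  have h5 : (6 : ℝ) / k = 6 * e := by rw [he]; ring
  rw [h5]
  calc d ^ 2 ≤ (r * (D * (1 + 1.32 * e))) ^ 2 := by gcongr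
    _ = (1 + 1.32 * e) ^ 2 * (b * D ^ 2) := by rw [← hr]; ring
    _ ≤ _ := by
      have : 0 ≤ b := by linarith
      gcongr

/-- A vector with small skew coordinates is short. -/
lemma norm_le_of_abs_sub_mul_le {X Y : Plane →ₗ[ℝ] ℝ} (hnorm : ∀ x, ‖x‖ ^ 2 = X x ^ 2 + Y x ^ 2)
    {m r s : ℝ} (hm : |m| ≤ 1) {z : Plane} (hr : |X z - m * Y z| ≤ r) (hs : |Y z| ≤ s) :
    ‖z‖ ≤ r + 2 * s := by
  have hX : |X z| ≤ r + s := by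
    have h1 : |m * Y z| ≤ |Y z| := by
      rw [abs_mul]; exact mul_le_of_le_one_left (abs_nonneg _) hm
    calc |X z| = |(X z - m * Y z) + m * Y z| := by rw [sub_add_cancel]
      _ ≤ |X z - m * Y z| + |m * Y z| := abs_add_le _ _
      _ ≤ r + s := by linarith
  have hXY : ‖z‖ ≤ |X z| + |Y z| := by
    refine le_of_sq_le_sq ?_ (by positivity)
    rw [hnorm, add_sq, sq_abs, sq_abs]
    have := mul_nonneg (abs_nonneg (X z)) (abs_nonneg (Y z))
    linarith
  linarith

/-- If `Q` contains the part of the convex set `P` below the height `h` over its point `v`, then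
its share of the area is at least `(h / T) ^ 2`, where `T` bounds the height of `P`. -/
lemma sq_le_mul_sq_of_volume_eq {P Q : Set Plane} (hP : Convex ℝ P)
    (hvol : 0 < (volume P).toReal) (hQ : volume Q ≠ ⊤) {t : Plane → ℝ}
    (ht : ∀ x y r, t (x + r • (y - x)) = t x + r * (t y - t x)) {v : Plane} (hv : v ∈ P)
    {T h b : ℝ} (hT : 0 < T) (hh : 0 ≤ h) (hhT : h ≤ T) (hmax : ∀ x ∈ P, t x - t v ≤ T)
    (hmem : ∀ x ∈ P, t x - t v ≤ h → x ∈ Q)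
    (hb : (volume Q).toReal = b * (volume P).toReal) :
    h ^ 2 ≤ b * T ^ 2 := by
  have hr : 0 ≤ h / T ∧ h / T ≤ 1 := ⟨by positivity, (div_le_one hT).2 hhT⟩
  have := sq_mul_volume_le_of_homothety (P := P) hQ v (h / T) fun x hx => by
    refine hmem _ (hP.add_smul_sub_mem hv hx hr) ?_
    rw [ht, add_sub_cancel_left]
    calc h / T * (t x - t v) ≤ h / T * T := mul_le_mul_of_nonneg_left (hmax x hx) hr.1
      _ = h := div_mul_cancel₀ _ hT.ne'
  rw [hb] at this
  have h1 := le_of_mul_le_mul_right this hvol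
  rwa [div_pow, div_le_iff₀ (by positivity)] at h1

/-- Cutting off an area fraction `a` at the apex `v` of a cone that contains `P` makes neither piece
much longer than its share of the area allows, unless it is fat. -/
lemma diam_sq_le_of_cone {k : ℝ} (hk3 : 3 ≤ k) {P : Set Plane} (hPconv : Convex ℝ P)
    (hPcomp : IsCompact P) (hvolpos : 0 < (volume P).toReal) {p q : Plane} (hp : p ∈ P)
    (hq : q ∈ P) (hpq : p ≠ q) (hdist : ∀ x ∈ P, ∀ y ∈ P, dist x y ≤ dist p q)
    {X Y : Plane →ₗ[ℝ] ℝ} (hnorm : ∀ x, ‖x‖ ^ 2 = X x ^ 2 + Y x ^ 2)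
    (hdet : ∀ u w : Plane, X u * Y w - Y u * X w = u 0 * w 1 - u 1 * w 0)
    (hXpq : X (q - p) = dist p q) (hYpq : Y (q - p) = 0) {v : Plane} (hv : v ∈ P) {m : ℝ}
    (hm : |m| ≤ 1) (hcone : ∀ x ∈ P, |Y (x - v)| ≤ k * (X (x - v) - m * Y (x - v)))
    {n : Plane} (hn : n ≠ 0) (hnXY : ∀ x, ⟪n, x⟫ = X x - m * Y x) {a c : ℝ} (ha0 : 0 < a)
    (ha2 : a ≤ 1 / 2) {P₁ P₂ : Set Plane} (hP₁ : P₁ = P ∩ {x | ⟪n, x⟫ ≤ c})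
    (hP₂ : P₂ = P ∩ {x | c ≤ ⟪n, x⟫}) (hc₁ : (volume P₁).toReal = a * (volume P).toReal)
    (hc₂ : (volume P₂).toReal = (1 - a) * (volume P).toReal) :
    (Metric.diam P₁ ^ 2 ≤ k ^ 8 * (a * (volume P).toReal) ∨
        Metric.diam P₁ ^ 2 ≤ (1 + 6 / k) * (a * dist p q ^ 2)) ∧
      (Metric.diam P₂ ^ 2 ≤ k ^ 8 * ((1 - a) * (volume P).toReal) ∨
        Metric.diam P₂ ^ 2 ≤ (1 + 6 / k) * ((1 - a) * dist p q ^ 2)) := by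
  have hPfin : volume P ≠ ⊤ := hPcomp.measure_lt_top.ne
  have hvol₁ : 0 < (volume P₁).toReal := by rw [hc₁]; positivity
  have hD : 0 < dist p q := dist_pos.2 hpq
  have hk0 : 0 < k := by linarith
  generalize hAdef : (volume P).toReal = A at *
  generalize hDdef : dist p q = D at *
  let t : Plane → ℝ := fun x => X (x - v) - m * Y (x - v)
  have ht : ∀ x, t x = ⟪n, x⟫ - ⟪n, v⟫ := fun x => by
    simp only [t, hnXY, map_sub]; ring
  have ht0 : ∀ x ∈ P, 0 ≤ t x := fun x hx =>
    nonneg_of_mul_nonneg_right ((abs_nonneg _).trans (hcone x hx)) hk0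
  set h := c - ⟪n, v⟫ with hh_def
  have hmem₁ : ∀ x, x ∈ P₁ ↔ x ∈ P ∧ t x ≤ h := fun x => by
    rw [ht, hh_def, sub_le_sub_iff_right, hP₁]; rfl
  have hmem₂ : ∀ x, x ∈ P₂ ↔ x ∈ P ∧ h ≤ t x := fun x => by
    rw [ht, hh_def, sub_le_sub_iff_right, hP₂]; rfl
  have hfin₁ : volume P₁ ≠ ⊤ := measure_ne_top_of_subset (hP₁ ▸ Set.inter_subset_left) hPfin
  have hfin₂ : volume P₂ ≠ ⊤ := measure_ne_top_of_subset (hP₂ ▸ Set.inter_subset_left) hPfin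
  have hh : 0 < h := by
    by_contra hcon
    have hsub : P₁ ⊆ {x | ⟪n, x⟫ = ⟪n, v⟫} := fun x hx => by
      have h1 := (hmem₁ x).1 hx
      have h2 := ht0 x h1.1
      have h3 := ht x
      have h4 : ⟪n, x⟫ = ⟪n, v⟫ := by linarith [h1.2]
      exact h4
    rw [measure_mono_null hsub (volume_setOf_inner_eq hn _)] at hvol₁
    simp at hvol₁
  have htcont : Continuous t := by
    have : t = fun x => ⟪n, x⟫ - ⟪n, v⟫ := funext ht
    rw [this]; fun_prop
  obtain ⟨w, hw, hwmax⟩ := hPcomp.exists_isMaxOn ⟨v, hv⟩ htcont.continuousOn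
  have hwmax' : ∀ x ∈ P, t x ≤ t w := fun x hx => hwmax hx
  set T := t w with hT_def
  have hhT : h < T := by
    by_contra hcon
    have : P₁ = P := Set.Subset.antisymm (fun x hx => ((hmem₁ x).1 hx).1) fun x hx =>
      (hmem₁ x).2 ⟨hx, (hwmax' x hx).trans (not_lt.1 hcon)⟩
    rw [this, hAdef] at hc₁
    linarith [mul_le_mul_of_nonneg_right ha2 hvolpos.le]
  have hT0 : 0 < T := hh.trans hhT
  have htadd : ∀ x y r, t (x + r • (y - x)) = t x + r * (t y - t x) := fun x y r => by
    simp only [ht, inner_add_right, inner_smul_right, inner_sub_right]; ring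
  have htv : t v = 0 := by simp [t]
  have hsq₁ : h ^ 2 ≤ a * T ^ 2 :=
    sq_le_mul_sq_of_volume_eq hPconv (hAdef ▸ hvolpos) hfin₁ htadd hv hT0 hh.le hhT.le
      (fun x hx => by rw [htv, sub_zero]; exact hwmax' x hx)
      (fun x hx hxh => (hmem₁ x).2 ⟨hx, by rwa [htv, sub_zero] at hxh⟩) (by rw [hAdef, hc₁])
  have hsq₂ : (T - h) ^ 2 ≤ (1 - a) * T ^ 2 :=
    sq_le_mul_sq_of_volume_eq (t := fun x => -t x) hPconv (hAdef ▸ hvolpos) hfin₂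
      (fun x y r => by rw [htadd]; ring) hw hT0 (sub_nonneg.2 hhT.le) (by linarith)
      (fun x hx => by linarith [ht0 x hx]) (fun x hx hxh => (hmem₂ x).2 ⟨hx, by linarith⟩)
      (by rw [hAdef, hc₂])
  have hd₁sq : Metric.diam P₁ ^ 2 ≤ 10 * k ^ 2 * h ^ 2 := by
    have hle : 8 * k ^ 2 + 4 * k + 1 ≤ 10 * k ^ 2 := by
      linarith [mul_le_mul_of_nonneg_right hk3 hk0.le, sq k]
    have : Metric.diam P₁ ≤ √((8 * k ^ 2 + 4 * k + 1) * h ^ 2) :=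
      Metric.diam_le_of_forall_dist_le (Real.sqrt_nonneg _) fun x hx y hy =>
        Real.le_sqrt_of_sq_le (dist_sq_le_of_mem_cap hnorm hm hk0 hcone
          ((hmem₁ x).1 hx).1 ((hmem₁ x).1 hx).2 ((hmem₁ y).1 hy).1 ((hmem₁ y).1 hy).2)
    calc Metric.diam P₁ ^ 2 ≤ √((8 * k ^ 2 + 4 * k + 1) * h ^ 2) ^ 2 :=
          pow_le_pow_left₀ Metric.diam_nonneg this 2
      _ = (8 * k ^ 2 + 4 * k + 1) * h ^ 2 := Real.sq_sqrt (by positivity)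
      _ ≤ _ := mul_le_mul_of_nonneg_right hle (sq_nonneg h)
  have hXle : ∀ z : Plane, |X z| ≤ ‖z‖ := fun z =>
    abs_le_of_sq_le_sq (by rw [hnorm]; linarith [sq_nonneg (Y z)]) (norm_nonneg z)
  have hd₂D : Metric.diam P₂ ≤ D :=
    Metric.diam_le_of_forall_dist_le hD.le fun x hx y hy =>
      hdist x ((hmem₂ x).1 hx).1 y ((hmem₂ y).1 hy).1
  rcases le_or_gt (20 * D ^ 2) (k ^ 6 * A) with hfat | hthin
  · have hk2 : (9 : ℝ) ≤ k ^ 2 := by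
      linarith [pow_le_pow_left₀ zero_le_three hk3 2]
    refine ⟨Or.inl ?_, Or.inl ?_⟩
    · have hTD : T ^ 2 ≤ 2 * D ^ 2 := by
        have h1 := hdist w hw v hv
        rw [dist_eq_norm] at h1
        have h2 := pow_le_pow_left₀ (norm_nonneg _) h1 2
        rw [hnorm] at h2
        have h3 : m ^ 2 ≤ 1 := by rw [sq_le_one_iff_abs_le_one]; exact hm
        have h4 : T = X (w - v) - m * Y (w - v) := rfl
        rw [h4]
        linarith [sq_nonneg (m * X (w - v) + Y (w - v)),
          mul_nonneg (sub_nonneg.2 h3) (add_nonneg (sq_nonneg (X (w - v))) (sq_nonneg (Y (w - v))))]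
      calc Metric.diam P₁ ^ 2 ≤ 10 * k ^ 2 * h ^ 2 := hd₁sq
        _ ≤ 10 * k ^ 2 * (a * T ^ 2) := by gcongr
        _ ≤ 10 * k ^ 2 * (a * (2 * D ^ 2)) := by gcongr
        _ = k ^ 2 * a * (20 * D ^ 2) := by ring
        _ ≤ k ^ 2 * a * (k ^ 6 * A) := by gcongr
        _ = _ := by ring
    · have h1 : Metric.diam P₂ ^ 2 ≤ D ^ 2 := pow_le_pow_left₀ Metric.diam_nonneg hd₂D 2
      have h2 : k ^ 6 * A ≤ k ^ 8 * A * (1 / 9) := by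
        have : k ^ 8 * A * (1 / 9) = k ^ 6 * A * (k ^ 2 / 9) := by ring
        rw [this]
        exact le_mul_of_one_le_right (by positivity) (by linarith)
      have h3 : 0 < k ^ 8 * A := by positivity
      have h4 : k ^ 8 * ((1 - a) * A) = k ^ 8 * A * (1 - a) := by ring
      rw [h4]
      linarith [mul_nonneg h3.le (sub_nonneg.2 ha2)]
  · set H := 2 * A / D with hH_def
    have hH0 : 0 ≤ H := by positivity
    have hHD : H * D = 2 * A := div_mul_cancel₀ _ hD.ne'
    have hH : 243 * k * H ≤ 40 * D := by
      have h1 : 243 * k ≤ k ^ 6 := by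
        have : (3 : ℝ) ^ 5 ≤ k ^ 5 := by gcongr
        calc 243 * k = 3 ^ 5 * k := by norm_num
          _ ≤ k ^ 5 * k := by gcongr
          _ = _ := by ring
      refine le_of_mul_le_mul_right ?_ hD
      calc 243 * k * H * D = 243 * k * (2 * A) := by rw [← hHD]; ring
        _ ≤ k ^ 6 * (2 * A) := by gcongr
        _ ≤ 40 * D * D := by linarith
    have hYp : ∀ x ∈ P, |Y (x - p)| ≤ H := by
      intro x hx
      have h1 := hPconv.abs_det_le_two_mul_volume hPfin hp hq hx
      simp only [← PiLp.sub_apply] at h1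
      rw [← hdet, hXpq, hYpq, zero_mul, sub_zero, abs_mul, abs_of_pos hD] at h1
      rw [hH_def, le_div_iff₀ hD]
      linarith
    have hYq : ∀ x, Y (x - p) = Y (x - q) := fun x => by
      have : x - p = (x - q) + (q - p) := by abel
      rw [this, map_add, hYpq, add_zero]
    have hXdist : ∀ x ∈ P, ∀ y ∈ P, X (x - y) ≤ D := fun x hx y hy =>
      (le_abs_self _).trans ((hXle _).trans (by rw [← dist_eq_norm]; exact hdist x hx y hy))
    have htsub : ∀ x y, t x - t y = X (x - y) - m * Y (x - y) := fun x y => by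
      simp only [t, map_sub]; ring
    have hmY : ∀ y : ℝ, |m * y| ≤ |y| := fun y => by
      rw [abs_mul]; exact mul_le_of_le_one_left (abs_nonneg _) hm
    have hτD : D ≤ t q := by
      have h1 := htsub q p
      rw [hXpq, hYpq] at h1
      linarith [ht0 p hp]
    have hτ0 : 0 < t q := hD.trans_le hτD
    have hTτ : T ≤ t q + H := by
      have h1 := htsub w q
      have h2 : X (w - q) ≤ 0 := by
        have h3 := hXdist w hw p hp
        have h4 : w - p = (w - q) + (q - p) := by abel
        rw [h4, map_add, hXpq] at h3
        linarith
      have h5 := (neg_le_abs _).trans ((hmY _).trans ((hYq w) ▸ hYp w hw))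
      linarith
    have hτle : t q ≤ D + H := by
      have h1 := htsub q v
      rw [htv] at h1
      have h2 := hXdist q hq v hv
      have h3 : Y (q - v) = - Y (v - p) := by
        rw [hYq, ← map_neg, neg_sub]
      have h4 : |Y (q - v)| ≤ H := by rw [h3, abs_neg]; exact hYp v hv
      have h5 := (neg_le_abs _).trans ((hmY (Y (q - v))).trans h4)
      linarith
    refine ⟨?_, Or.inr ?_⟩
    · by_contra! hcon
      obtain ⟨hcon₁, hcon₂⟩ := hcon
      refine hcon₂.not_ge ?_
      have hhτ : h ≤ t q := by
        have h1 : h ^ 2 ≤ (t q) ^ 2 := by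
          have h2 : 20 * H ≤ 2 * t q := by
            linarith [mul_le_mul_of_nonneg_right hk3 hH0]
          have h3 : T ≤ 1.1 * t q := by linarith
          have h4 : T ^ 2 ≤ (1.1 * t q) ^ 2 := pow_le_pow_left₀ hT0.le h3 2
          linarith [mul_le_mul_of_nonneg_right ha2 (sq_nonneg T), sq_nonneg (t q)]
        exact le_of_sq_le_sq h1 (hD.le.trans hτD)
      refine narrow_cap_estimate hk3 Metric.diam_nonneg hh hD hvolpos.le ha0.le hsq₁ hT0.le hTτ hτD
        hH (by linarith) hd₁sq ?_
      refine Metric.diam_le_of_forall_dist_le (by positivity) fun x hx y hy => ?_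
      rw [← hc₁]
      exact dist_le_of_mem_cap hnorm hdet hm hPconv hPfin hv hq (hdist q hq v hv) ht0 hh hhτ
        hmem₁ hx hy
    · refine remaining_piece_estimate hk3 Metric.diam_nonneg hD (by linarith) hsq₂ hT0.le
        (by linarith) hH0 hH ?_
      refine Metric.diam_le_of_forall_dist_le (by linarith) fun x hx y hy => ?_
      have hx' := (hmem₂ x).1 hx
      have hy' := (hmem₂ y).1 hy
      have h1 : |t x - t y| ≤ T - h := by
        rw [abs_le]
        constructor <;> linarith [hwmax' x hx'.1, hwmax' y hy'.1, hx'.2, hy'.2]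
      have h2 : |Y (x - y)| ≤ 2 * H := by
        have h3 : x - y = (x - p) - (y - p) := by abel
        rw [h3, map_sub]
        exact (abs_sub _ _).trans (by linarith [hYp x hx'.1, hYp y hy'.1])
      rw [htsub] at h1
      rw [dist_eq_norm]
      linarith [norm_le_of_abs_sub_mul_le hnorm hm h1 h2]

/-- Good-cuts lemma: let `P ⊂ ℝ²` be a (nondegenerate) convex polygon with `k` vertices
and let `a ∈ (0, 1/2]`. Then `P` can be partitioned by a single straight-line cut into
two convex polygons `P₁` and `P₂`, each with at most `k+1` vertices, with
`area(P₁) = a·area(P)`, `area(P₂) = (1-a)·area(P)`, and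
`max(ar(P₁), ar(P₂)) ≤ max(ar(P)·(1 + 6/k), k⁸)`. -/
theorem stmt7 (k : ℕ) (hk : 3 ≤ k) (V : Finset Plane) (hcard : V.card = k)
    (hvert : ∀ v ∈ V, v ∉ convexHull ℝ ((V : Set Plane) \ {v}))
    (P : Set Plane) (hP : P = convexHull ℝ (V : Set Plane))
    (hint : (interior P).Nonempty)
    (a : ℝ) (ha : a ∈ Set.Ioc (0:ℝ) (1/2)) :
    ∃ (n : Plane) (c : ℝ) (P₁ P₂ : Set Plane), n ≠ 0 ∧
      P₁ = P ∩ {x | ⟪n, x⟫ ≤ c} ∧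
      P₂ = P ∩ {x | c ≤ ⟪n, x⟫} ∧
      (∃ V₁ : Finset Plane, P₁ = convexHull ℝ (V₁ : Set Plane) ∧ V₁.card ≤ k + 1) ∧
      (∃ V₂ : Finset Plane, P₂ = convexHull ℝ (V₂ : Set Plane) ∧ V₂.card ≤ k + 1) ∧
      (volume P₁).toReal = a * (volume P).toReal ∧
      (volume P₂).toReal = (1 - a) * (volume P).toReal ∧
      max (aspectRatio P₁) (aspectRatio P₂) ≤
        max (aspectRatio P * (1 + 6 / (k : ℝ))) ((k : ℝ) ^ 8) := by
  have hVne : V.Nonempty := Finset.card_pos.1 (by omega)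
  have hk3 : (3 : ℝ) ≤ k := by exact_mod_cast hk
  have hPconv : Convex ℝ P := hP ▸ convex_convexHull ℝ _
  have hPcomp : IsCompact P := hP ▸ V.finite_toSet.isCompact_convexHull (𝕜 := ℝ)
  have hPne : P.Nonempty := hint.mono interior_subset
  have hPfin : volume P ≠ ⊤ := hPcomp.measure_lt_top.ne
  have hvolpos : 0 < (volume P).toReal :=
    ENNReal.toReal_pos (Measure.measure_pos_of_nonempty_interior _ hint).ne' hPfin
  obtain ⟨ha0, ha2⟩ := ha
  obtain ⟨p, hp, q, hq, hdist⟩ : ∃ p ∈ P, ∃ q ∈ P, ∀ x ∈ P, ∀ y ∈ P, dist x y ≤ dist p q := by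
    obtain ⟨z, hz, hmax⟩ := (hPcomp.prod hPcomp).exists_isMaxOn (hPne.prod hPne)
      (f := fun x : Plane × Plane => dist x.1 x.2) (by fun_prop)
    rw [isMaxOn_iff] at hmax
    exact ⟨z.1, hz.1, z.2, hz.2, fun x hx y hy => hmax (x, y) ⟨hx, hy⟩⟩
  have hdiam : Metric.diam P = dist p q :=
    le_antisymm (Metric.diam_le_of_forall_dist_le dist_nonneg hdist)
      (Metric.dist_le_diam_of_mem hPcomp.isBounded hp hq)
  have hpq : p ≠ q := by
    intro hpq
    have hsub : P.Subsingleton := fun x hx y hy =>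
      dist_le_zero.1 ((hdist x hx y hy).trans_eq (by rw [hpq, dist_self]))
    exact hvolpos.ne' (by rw [hsub.measure_zero]; rfl)
  obtain ⟨X, Y, hnorm, hdet, hXpq, hYpq, hex⟩ := exists_rotated_coordinates hpq
  obtain ⟨v, hvV, m, hm, hcone⟩ := exists_vertex_cone V hVne X Y
  rw [hcard, ← hP] at hcone
  have hv : v ∈ P := hP ▸ subset_convexHull ℝ _ hvV
  obtain ⟨n, hn, hnXY⟩ := hex m
  obtain ⟨c, hc₁, hc₂⟩ := hPcomp.exists_cut hPne hn ha0.le (by linarith)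
  set D := dist p q
  set A := (volume P).toReal
  set P₁ := P ∩ {x | ⟪n, x⟫ ≤ c} with hP₁
  set P₂ := P ∩ {x | c ≤ ⟪n, x⟫} with hP₂
  have hne : ∀ {Q : Set Plane}, 0 < (volume Q).toReal → Q.Nonempty := by
    intro Q hQ
    by_contra h
    rw [Set.not_nonempty_iff_eq_empty.1 h] at hQ
    simp at hQ
  have hvol₁ : 0 < (volume P₁).toReal := by rw [hc₁]; positivity
  have hvol₂ : 0 < (volume P₂).toReal := by
    rw [hc₂]; exact mul_pos (by linarith) hvolpos
  have hmain := diam_sq_le_of_cone hk3 hPconv hPcomp hvolpos hp hq hpq hdist hnorm hdet hXpq hYpq hv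
    hm hcone hn hnXY ha0 ha2 hP₁ hP₂ hc₁ hc₂
  obtain ⟨W₁, hW₁, hW₁c⟩ := exists_finset_convexHull_inter_le V n c (hP ▸ hne hvol₁) hn
  obtain ⟨W₂, hW₂, hW₂c⟩ := exists_finset_convexHull_inter_ge V n c (hP ▸ hne hvol₂) hn
  refine ⟨n, c, P₁, P₂, hn, rfl, rfl, ⟨W₁, by rw [hP₁, hP, hW₁], hcard ▸ hW₁c⟩,
    ⟨W₂, by rw [hP₂, hP, hW₂], hcard ▸ hW₂c⟩, hc₁, hc₂, ?_⟩
  have haux : ∀ (Q : Set Plane) (b : ℝ), 0 < b → (volume Q).toReal = b * A →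
      (Metric.diam Q ^ 2 ≤ (k : ℝ) ^ 8 * (b * A) ∨
        Metric.diam Q ^ 2 ≤ (1 + 6 / k) * (b * D ^ 2)) →
      aspectRatio Q ≤ max (aspectRatio P * (1 + 6 / (k : ℝ))) ((k : ℝ) ^ 8) := by
    intro Q b hb hQ hor
    have hbA : 0 < b * A := mul_pos hb hvolpos
    rw [aspectRatio, aspectRatio, hQ, hdiam]
    rcases hor with h | h
    · exact le_max_of_le_right ((div_le_iff₀ hbA).2 h)
    · refine le_max_of_le_left ((div_le_iff₀ hbA).2 (h.trans (le_of_eq ?_)))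
      have : A ≠ 0 := hvolpos.ne'
      change _ = D ^ 2 / A * (1 + 6 / (k : ℝ)) * (b * A)
      field_simp
  exact max_le (haux P₁ a ha0 hc₁ hmain.1) (haux P₂ (1 - a) (by linarith) hc₂ hmain.2)
end
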